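/- arXiv:1612.02592 — 4 statements merged into one kernel-verified Lean document; each statement's English description precedes it below -/
import Mathlib

section
/- Let (X,ρ) be a compact metric space, f : X → X continuous, k a positive integer, and x ∈ X. Then the upper local correlation entropy satisfies entr⁺(f^k, x) = k · entr⁺(f, x) and the lower local correlation entropy satisfies entr⁻(f^k, x) = k · entr⁻(f, x). -/
open Filter Topology Set MeasureTheory

section Defs

variable {X : Type*} [MetricSpace X]

/-- Bowen's metric `ρ^f_m(y,z) = max_{0 ≤ i < m} ρ(f^i y, f^i z)`. -/
noncomputable def bowenDist (f : X → X) (m : ℕ) (y z : X) : ℝ :=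
  (((Finset.range m).sup fun i => nndist (f^[i] y) (f^[i] z)) : NNReal)

open scoped Classical in
/-- The correlation sum `C^f_m(x,n,ε)`. -/
noncomputable def corrSum (f : X → X) (m : ℕ) (x : X) (n : ℕ) (ε : ℝ) : ℝ :=
  (((Finset.range n ×ˢ Finset.range n).filter fun q =>
      bowenDist f m (f^[q.1] x) (f^[q.2] x) ≤ ε).card : ℝ) / (n : ℝ) ^ 2

/-- `ĉ^f_m(x,ε) = limsup_{n→∞} C^f_m(x,n,ε)`. -/
noncomputable def corrUpper (f : X → X) (m : ℕ) (x : X) (ε : ℝ) : ℝ :=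
  Filter.limsup (fun n : ℕ => corrSum f m x n ε) Filter.atTop

/-- `č^f_m(x,ε) = liminf_{n→∞} C^f_m(x,n,ε)`. -/
noncomputable def corrLower (f : X → X) (m : ℕ) (x : X) (ε : ℝ) : ℝ :=
  Filter.liminf (fun n : ℕ => corrSum f m x n ε) Filter.atTop

/-- The upper local correlation entropy `entr⁺(f,x) = lim_{ε→0⁺} limsup_m (−1/m) log č^f_m(x,ε)`;
the limit as `ε → 0⁺` exists by monotonicity in `ε`, and is expressed here as a `limsup`
along `𝓝[>] 0` (with values in `EReal`). -/
noncomputable def entrUpper (f : X → X) (x : X) : EReal :=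
  Filter.limsup (fun ε : ℝ =>
      Filter.limsup (fun m : ℕ => ((-(1 / (m : ℝ)) * Real.log (corrLower f m x ε) : ℝ) : EReal))
        Filter.atTop)
    (𝓝[>] (0 : ℝ))

/-- The lower local correlation entropy `entr⁻(f,x) = lim_{ε→0⁺} liminf_m (−1/m) log ĉ^f_m(x,ε)`. -/
noncomputable def entrLower (f : X → X) (x : X) : EReal :=
  Filter.limsup (fun ε : ℝ =>
      Filter.liminf (fun m : ℕ => ((-(1 / (m : ℝ)) * Real.log (corrUpper f m x ε) : ℝ) : EReal))
        Filter.atTop)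
    (𝓝[>] (0 : ℝ))

/-- `r_m(ε,K)`: the smallest cardinality of a subset of `K` which `(m,ε)`-spans `K`. -/
noncomputable def spanNumOn (f : X → X) (K : Set X) (m : ℕ) (ε : ℝ) : ℕ :=
  sInf {k : ℕ | ∃ A : Finset X, ↑A ⊆ K ∧ A.card = k ∧ ∀ y ∈ K, ∃ a ∈ A, bowenDist f m y a ≤ ε}

/-- Bowen's topological entropy of `f` on `K` (for `K = univ`, of `f` itself;
for closed invariant `K`, of the restriction of `f` to `K`). -/
noncomputable def topEntropyOn (f : X → X) (K : Set X) : EReal :=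
  Filter.limsup (fun ε : ℝ =>
      Filter.limsup (fun n : ℕ => (((1 / (n : ℝ)) * Real.log (spanNumOn f K n ε) : ℝ) : EReal))
        Filter.atTop)
    (𝓝[>] (0 : ℝ))

end Defs

open scoped Classical in
/-- The number of pairs of times below `n` counted by the correlation sum. -/
noncomputable def corrCount {X : Type*} [MetricSpace X] (f : X → X) (m : ℕ) (x : X) (n : ℕ)
    (ε : ℝ) : ℕ :=
  ((Finset.range n ×ˢ Finset.range n).filter fun q =>
      bowenDist f m (f^[q.1] x) (f^[q.2] x) ≤ ε).card

section Counting

open scoped Classical in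
/-- In a bipartite graph, the edges whose left degree is at most their right degree are no more
numerous than the pairs of left vertices having a common neighbour. -/
theorem card_edges_filter_le {ι κ : Type*} (I : Finset ι) (J : Finset κ) (E : ι → κ → Prop)
    (S : ι → ι → Prop) (hS : ∀ i i' j, E i j → E i' j → S i i') :
    ((I ×ˢ J).filter fun q => E q.1 q.2 ∧
      (J.filter fun j => E q.1 j).card ≤ (I.filter fun i => E i q.2).card).card ≤
    ((I ×ˢ I).filter fun q => S q.1 q.2).card := by
  simp only [Finset.card_filter _ (I ×ˢ J), Finset.card_filter _ (I ×ˢ I), Finset.sum_product]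
  refine Finset.sum_le_sum fun i _ => ?_
  rw [← Finset.card_filter, ← Finset.card_filter]
  rcases Finset.eq_empty_or_nonempty (J.filter fun j => E i j ∧
      (J.filter fun j => E i j).card ≤ (I.filter fun i => E i j).card) with h | ⟨j, hj⟩
  · rw [h]; simp
  · obtain ⟨-, hij, hle⟩ := Finset.mem_filter.1 hj
    calc _ ≤ (J.filter fun j => E i j).card :=
          Finset.card_le_card (Finset.monotone_filter_right _ fun _ _ h => h.1)
      _ ≤ (I.filter fun i => E i j).card := hle
      _ ≤ _ := Finset.card_le_card (Finset.monotone_filter_right _ fun i' _ h => hS i i' j hij h)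

open scoped Classical in
/-- The number of edges of a bipartite graph is at most the number of pairs of left vertices with
a common neighbour plus the number of pairs of right vertices with a common neighbour. -/
theorem card_edges_le {ι κ : Type*} (I : Finset ι) (J : Finset κ) (E : ι → κ → Prop)
    (S : ι → ι → Prop) (T : κ → κ → Prop) (hS : ∀ i i' j, E i j → E i' j → S i i')
    (hT : ∀ i j j', E i j → E i j' → T j j') :
    ((I ×ˢ J).filter fun q => E q.1 q.2).card ≤
    ((I ×ˢ I).filter fun q => S q.1 q.2).card + ((J ×ˢ J).filter fun q => T q.1 q.2).card := by
  have h1 := card_edges_filter_le I J E S hS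
  have h2 := card_edges_filter_le J I (fun j i => E i j) T (fun j j' i => hT i j j')
  have h3 : ((I ×ˢ J).filter fun q => E q.1 q.2 ∧
      (I.filter fun i => E i q.2).card ≤ (J.filter fun j => E q.1 j).card).card ≤
      ((J ×ˢ I).filter fun q => E q.2 q.1 ∧
      (I.filter fun i => E i q.1).card ≤ (J.filter fun j => E q.2 j).card).card := by
    refine Finset.card_le_card_of_injOn Prod.swap ?_ Prod.swap_injective.injOn
    rintro ⟨i, j⟩ h
    simp only [Finset.coe_filter, Finset.mem_product, Set.mem_ofPred_eq, Prod.fst_swap,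
      Prod.snd_swap] at h ⊢
    tauto
  refine le_trans (Finset.card_le_card (t := _ ∪ _) ?_) ((Finset.card_union_le _ _).trans
    (add_le_add h1 (h3.trans h2)))
  rintro ⟨i, j⟩ h
  simp only [Finset.mem_union, Finset.mem_filter, Finset.mem_product] at h ⊢
  rcases le_total (J.filter fun j => E i j).card (I.filter fun i => E i j).card with h' | h'
  · exact Or.inl ⟨h.1, h.2, h'⟩
  · exact Or.inr ⟨h.1, h.2, h'⟩

end Counting

section Correlation

variable {X : Type*} [MetricSpace X]

theorem bowenDist_le_iff {f : X → X} {m : ℕ} {y z : X} {ε : ℝ} (hε : 0 ≤ ε) :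
    bowenDist f m y z ≤ ε ↔ ∀ i < m, dist (f^[i] y) (f^[i] z) ≤ ε := by
  lift ε to NNReal using hε
  simp only [bowenDist, NNReal.coe_le_coe, Finset.sup_le_iff, Finset.mem_range, ← coe_nndist]

theorem corrSum_eq (f : X → X) (m : ℕ) (x : X) (n : ℕ) (ε : ℝ) :
    corrSum f m x n ε = (corrCount f m x n ε : ℝ) / (n : ℝ) ^ 2 := rfl

theorem corrCount_eq (f : X → X) (m : ℕ) (x : X) {n : ℕ} (hn : n ≠ 0) (ε : ℝ) :
    (corrCount f m x n ε : ℝ) = corrSum f m x n ε * (n : ℝ) ^ 2 := by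
  rw [corrSum_eq]; field_simp

theorem corrSum_nonneg (f : X → X) (m : ℕ) (x : X) (n : ℕ) (ε : ℝ) : 0 ≤ corrSum f m x n ε := by
  rw [corrSum_eq]; positivity

theorem corrSum_le_one (f : X → X) (m : ℕ) (x : X) (n : ℕ) (ε : ℝ) : corrSum f m x n ε ≤ 1 := by
  rw [corrSum_eq]
  refine div_le_one_of_le₀ ?_ (by positivity)
  have : corrCount f m x n ε ≤ n * n := by
    refine (Finset.card_filter_le _ _).trans ?_
    simp
  rw [sq]; exact_mod_cast this

theorem corrCount_mono (f : X → X) (m : ℕ) (x : X) {n n' : ℕ} (h : n ≤ n') (ε : ℝ) :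
    corrCount f m x n ε ≤ corrCount f m x n' ε := by
  refine Finset.card_le_card (Finset.filter_subset_filter _ (Finset.product_subset_product ?_ ?_))
    <;> exact Finset.range_subset_range.2 h

theorem corrCount_antitone_length (f : X → X) {m m' : ℕ} (h : m ≤ m') (x : X) (n : ℕ) {ε : ℝ}
    (hε : 0 ≤ ε) : corrCount f m' x n ε ≤ corrCount f m x n ε := by
  refine Finset.card_le_card (Finset.monotone_filter_right _ fun q _ hq => ?_)
  simp only [bowenDist_le_iff hε] at hq ⊢
  exact fun i hi => hq i (hi.trans_le h)

theorem corrSum_antitone_length (f : X → X) {m m' : ℕ} (h : m ≤ m') (x : X) (n : ℕ) {ε : ℝ}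
    (hε : 0 ≤ ε) : corrSum f m' x n ε ≤ corrSum f m x n ε := by
  rw [corrSum_eq, corrSum_eq]
  gcongr
  exact corrCount_antitone_length f h x n hε

theorem corrCount_iterate_le {f : X → X} {k : ℕ} (hk : 0 < k) {ε δ : ℝ} (hε : 0 ≤ ε) (hδ : 0 ≤ δ)
    (h : ∀ y z, dist y z ≤ δ → ∀ i < k, dist (f^[i] y) (f^[i] z) ≤ ε) (m : ℕ) (x : X) (n : ℕ) :
    corrCount (f^[k]) m x n δ ≤ corrCount f (k * m) x (k * n) ε := by
  refine Finset.card_le_card_of_injOn (fun q => (k * q.1, k * q.2)) ?_ ?_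
  · rintro ⟨i, j⟩ hij
    simp only [Finset.coe_filter, Finset.mem_product, Finset.mem_range, Set.mem_ofPred_eq,
      bowenDist_le_iff hε, bowenDist_le_iff hδ] at hij ⊢
    refine ⟨⟨by gcongr; exact hij.1.1, by gcongr; exact hij.1.2⟩, fun l hl => ?_⟩
    have h1 := h _ _ (hij.2 (l / k) (Nat.div_lt_of_lt_mul hl)) (l % k) (Nat.mod_lt _ hk)
    simpa only [← Function.iterate_mul, ← Function.iterate_add_apply, ← add_assoc,
      Nat.mod_add_div] using h1
  · rintro ⟨i, j⟩ - ⟨i', j'⟩ - h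
    simpa [hk.ne'] using h

theorem corrCount_le_iterate {f : X → X} {k : ℕ} (hk : 0 < k) {ε δ : ℝ} (hδ : 0 ≤ δ)
    (hε : 2 * δ ≤ ε) (m : ℕ) (x : X) (n : ℕ) :
    corrCount f (k * (m + 1)) x (k * n) δ ≤ 2 * k ^ 2 * corrCount (f^[k]) m x (n + 1) ε := by
  classical
  have hε0 : 0 ≤ ε := by linarith
  obtain ⟨R, hR⟩ : ∃ R : ℕ → ℕ → Prop, ∀ a b, R a b ↔ ∀ l < k * (m + 1),
    dist (f^[l] (f^[a] x)) (f^[l] (f^[b] x)) ≤ δ := ⟨_, fun _ _ => Iff.rfl⟩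
  obtain ⟨S, hS⟩ : ∃ S : ℕ → ℕ → Prop, ∀ a b, S a b ↔ ∀ l < k * (m + 1),
    dist (f^[l] (f^[a] x)) (f^[l] (f^[b] x)) ≤ ε := ⟨_, fun _ _ => Iff.rfl⟩
  have hS1 : ∀ a b c, R a c → R b c → S a b := fun a b c h1 h2 => (hS a b).2 fun l hl => by
    rw [hR] at h1 h2
    have := dist_triangle_right (f^[l] (f^[a] x)) (f^[l] (f^[b] x)) (f^[l] (f^[c] x))
    linarith [h1 l hl, h2 l hl]
  have hS2 : ∀ a b c, R c a → R c b → S a b := fun a b c h1 h2 => (hS a b).2 fun l hl => by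
    rw [hR] at h1 h2
    have := dist_triangle_left (f^[l] (f^[a] x)) (f^[l] (f^[b] x)) (f^[l] (f^[c] x))
    linarith [h1 l hl, h2 l hl]
  have hdiag : ∀ r < k, ((Finset.range n ×ˢ Finset.range n).filter fun q =>
      S (k * q.1 + r) (k * q.2 + r)).card ≤ corrCount (f^[k]) m x (n + 1) ε := by
    intro r hr
    refine Finset.card_le_card_of_injOn (fun q => (q.1 + 1, q.2 + 1)) ?_ ?_
    · rintro ⟨i, j⟩ hij
      simp only [Finset.coe_filter, Finset.mem_product, Finset.mem_range, Set.mem_ofPred_eq,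
        bowenDist_le_iff hε0, hS] at hij ⊢
      refine ⟨⟨by omega, by omega⟩, fun l hl => ?_⟩
      have hkl : k * (l + 1) ≤ k * m := Nat.mul_le_mul_left k hl
      have h1 := hij.2 (k * l + (k - r)) (by
        rw [mul_add] at hkl ⊢
        omega)
      have e : ∀ i, k * l + (k - r) + (k * i + r) = k * l + k * (i + 1) := fun i => by
        rw [mul_add]; omega
      simp only [← Function.iterate_mul, ← Function.iterate_add_apply, e] at h1 ⊢
      exact h1
    · rintro ⟨i, j⟩ - ⟨i', j'⟩ - h
      simpa using h
  have hcover : ((Finset.range (k * n) ×ˢ Finset.range (k * n)).filter fun q =>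
      bowenDist f (k * (m + 1)) (f^[q.1] x) (f^[q.2] x) ≤ δ) ⊆
      (Finset.range k ×ˢ Finset.range k).biUnion fun p =>
        ((Finset.range n ×ˢ Finset.range n).filter fun q =>
          R (k * q.1 + p.1) (k * q.2 + p.2)).image
            fun q => (k * q.1 + p.1, k * q.2 + p.2) := by
    rintro ⟨a, b⟩ hab
    simp only [Finset.mem_filter, Finset.mem_product, Finset.mem_range, bowenDist_le_iff hδ,
      Finset.mem_biUnion, Finset.mem_image] at hab ⊢
    refine ⟨(a % k, b % k), ⟨Nat.mod_lt _ hk, Nat.mod_lt _ hk⟩, (a / k, b / k),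
      ⟨⟨Nat.div_lt_of_lt_mul hab.1.1, Nat.div_lt_of_lt_mul hab.1.2⟩, ?_⟩, ?_⟩
    · simpa only [Nat.div_add_mod, hR] using hab.2
    · simp only [Nat.div_add_mod]
  calc corrCount f (k * (m + 1)) x (k * n) δ ≤ _ := Finset.card_le_card hcover
    _ ≤ (Finset.range k ×ˢ Finset.range k).card * (2 * corrCount (f^[k]) m x (n + 1) ε) := by
      refine Finset.card_biUnion_le_card_mul _ _ _ fun p hp => Finset.card_image_le.trans ?_
      simp only [Finset.mem_product, Finset.mem_range] at hp
      have := card_edges_le (Finset.range n) (Finset.range n)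
        (fun i j => R (k * i + p.1) (k * j + p.2)) (fun i j => S (k * i + p.1) (k * j + p.1))
        (fun i j => S (k * i + p.2) (k * j + p.2)) (fun _ _ _ => hS1 _ _ _)
        (fun _ _ _ => hS2 _ _ _)
      have h1 := hdiag p.1 hp.1
      have h2 := hdiag p.2 hp.2
      omega
    _ = _ := by simp; ring

theorem corrSum_iterate_le {f : X → X} {k : ℕ} (hk : 0 < k) {ε δ : ℝ} (hε : 0 ≤ ε) (hδ : 0 ≤ δ)
    (h : ∀ y z, dist y z ≤ δ → ∀ i < k, dist (f^[i] y) (f^[i] z) ≤ ε) (m : ℕ) (x : X) {n : ℕ}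
    (hn : 0 < n) :
    corrSum (f^[k]) m x n δ ≤ k ^ 2 * corrSum f (k * m) x (k * n) ε := by
  have h1 : (corrCount (f^[k]) m x n δ : ℝ) ≤ corrCount f (k * m) x (k * n) ε := by
    exact_mod_cast corrCount_iterate_le hk hε hδ h m x n
  rw [corrSum_eq, corrSum_eq, div_le_iff₀ (by positivity)]
  refine h1.trans_eq ?_
  push_cast
  field_simp

theorem corrSum_le_iterate {f : X → X} {k : ℕ} (hk : 0 < k) {ε δ : ℝ} (hδ : 0 ≤ δ)
    (hε : 2 * δ ≤ ε) (m : ℕ) (x : X) {n : ℕ} (hn : 0 < n) :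
    corrSum f (k * (m + 1)) x (k * n) δ ≤ 8 * corrSum (f^[k]) m x (n + 1) ε := by
  have h1 : (corrCount f (k * (m + 1)) x (k * n) δ : ℝ) ≤
      2 * k ^ 2 * corrCount (f^[k]) m x (n + 1) ε := by
    exact_mod_cast corrCount_le_iterate hk hδ hε m x n
  rw [corrSum_eq, div_le_iff₀ (by positivity)]
  refine h1.trans ?_
  rw [corrCount_eq _ _ _ (by omega)]
  have hn1 : (1 : ℝ) ≤ n := by exact_mod_cast hn
  have h2 : ((n : ℝ) + 1) ^ 2 ≤ 4 * n ^ 2 := by nlinarith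
  have h3 := mul_le_mul_of_nonneg_left h2
    (mul_nonneg (by positivity : (0 : ℝ) ≤ 2 * k ^ 2) (corrSum_nonneg (f^[k]) m x (n + 1) ε))
  push_cast
  linarith

theorem corrSum_le_of_le_two_mul (f : X → X) (m : ℕ) (x : X) {n n' : ℕ} (hn : 0 < n)
    (h : n ≤ n') (h' : n' ≤ 2 * n) (ε : ℝ) : corrSum f m x n ε ≤ 4 * corrSum f m x n' ε := by
  have h1 : (corrCount f m x n ε : ℝ) ≤ corrCount f m x n' ε := by
    exact_mod_cast corrCount_mono f m x h ε
  rw [corrSum_eq, div_le_iff₀ (by positivity)]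
  refine h1.trans ?_
  rw [corrCount_eq _ _ _ (by omega)]
  have h2 : (n' : ℝ) ≤ 2 * n := by exact_mod_cast h'
  have h3 : (n' : ℝ) ^ 2 ≤ (2 * n) ^ 2 := by gcongr
  have h4 := mul_le_mul_of_nonneg_left h3 (corrSum_nonneg f m x n' ε)
  linarith

/-- Correlation sums are bounded below uniformly in the number of points. -/
theorem exists_pos_le_corrSum [CompactSpace X] {f : X → X} (hf : Continuous f) (m : ℕ) (x : X)
    {ε : ℝ} (hε : 0 < ε) : ∃ c > 0, ∀ n > 0, c ≤ corrSum f m x n ε := by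
  classical
  let U : X → Set X := fun c => {y | ∀ i ∈ Finset.range m, dist (f^[i] y) (f^[i] c) < ε / 2}
  have hU : ∀ c, U c ∈ 𝓝 c := fun c => by
    refine (Filter.eventually_all_finset _).2 fun i _ => ?_
    exact ((hf.iterate i).tendsto c) (Metric.ball_mem_nhds _ (half_pos hε))
  obtain ⟨t, -, ht⟩ := isCompact_univ.elim_nhds_subcover U fun c _ => hU c
  have ht' : ∀ y, ∃ c ∈ t, y ∈ U c := fun y => by simpa using ht (mem_univ y)
  choose p hpt hp using ht'
  have hne : 0 < t.card := Finset.card_pos.2 ⟨p x, hpt x⟩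
  refine ⟨1 / t.card, by positivity, fun n hn => ?_⟩
  have hfib : (n : ℝ) = ∑ c ∈ t, (((Finset.range n).filter fun i => p (f^[i] x) = c).card : ℝ) := by
    have := Finset.card_eq_sum_card_fiberwise (s := Finset.range n) (t := t)
      (f := fun i => p (f^[i] x)) (fun i _ => hpt _)
    rw [Finset.card_range] at this
    exact_mod_cast this
  have hcs : (n : ℝ) ^ 2 ≤ t.card *
      ∑ c ∈ t, (((Finset.range n).filter fun i => p (f^[i] x) = c).card : ℝ) ^ 2 := by
    conv_lhs => rw [hfib]
    exact sq_sum_le_card_mul_sum_sq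
  have hcount : ∑ c ∈ t, ((Finset.range n).filter fun i => p (f^[i] x) = c).card ^ 2 ≤
      corrCount f m x n ε := by
    simp only [sq, ← Finset.card_product]
    rw [← Finset.card_biUnion]
    · refine Finset.card_le_card ?_
      rintro ⟨i, j⟩ hij
      simp only [Finset.mem_biUnion, Finset.mem_product, Finset.mem_filter] at hij ⊢
      obtain ⟨c, -, ⟨hi, hic⟩, hj, hjc⟩ := hij
      refine ⟨⟨hi, hj⟩, (bowenDist_le_iff hε.le).2 fun l hl => ?_⟩
      have h1 := hp (f^[i] x) l (Finset.mem_range.2 hl)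
      have h2 := hp (f^[j] x) l (Finset.mem_range.2 hl)
      rw [hic] at h1
      rw [hjc] at h2
      have := dist_triangle_right (f^[l] (f^[i] x)) (f^[l] (f^[j] x)) (f^[l] c)
      linarith
    · intro c _ c' _ hcc
      rw [Function.onFun, Finset.disjoint_left]
      rintro ⟨i, j⟩ h1 h2
      simp only [Finset.mem_product, Finset.mem_filter] at h1 h2
      exact hcc (h1.1.2.symm.trans h2.1.2)
  have hcount' : ∑ c ∈ t, (((Finset.range n).filter fun i => p (f^[i] x) = c).card : ℝ) ^ 2 ≤
      corrCount f m x n ε := by exact_mod_cast hcount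
  rw [corrSum_eq, div_le_div_iff₀ (by positivity) (by positivity), one_mul, mul_comm]
  exact hcs.trans (by gcongr)

end Correlation

section Limits

theorem limsup_le_mul_limsup_comp {u v : ℕ → ℝ} {c : ℝ} {φ : ℕ → ℕ} (hc : 0 < c)
    (hu : ∀ n, 0 ≤ u n) (hv : ∀ n, v n ≤ 1) (hφ : Tendsto φ atTop atTop)
    (h : ∀ᶠ n in atTop, u n ≤ c * v (φ n)) :
    limsup u atTop ≤ c * limsup v atTop := by
  rw [mul_comm, ← div_le_iff₀ hc]
  refine le_of_forall_gt fun b hb => ?_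
  obtain ⟨b', hb', hbb⟩ := exists_between hb
  refine lt_of_le_of_lt ?_ hbb
  rw [div_le_iff₀ hc]
  refine limsup_le_of_le (isCoboundedUnder_le_of_le atTop (x := 0) hu) ?_
  have hev := eventually_lt_of_limsup_lt hb' (isBoundedUnder_of ⟨1, hv⟩)
  filter_upwards [h, hφ.eventually hev] with n h1 h2
  nlinarith

theorem liminf_le_mul_liminf_comp {u v : ℕ → ℝ} {c : ℝ} {φ : ℕ → ℕ} (hc : 0 < c)
    (hu : ∀ n, 0 ≤ u n) (hv : ∀ n, v n ≤ 1) (hφ : Tendsto φ atTop atTop)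
    (h : ∀ᶠ n in atTop, u (φ n) ≤ c * v n) :
    liminf u atTop ≤ c * liminf v atTop := by
  refine le_of_forall_lt fun b hb => ?_
  obtain ⟨b', hbb, hb'⟩ := exists_between hb
  refine lt_of_lt_of_le hbb ?_
  rw [mul_comm, ← div_le_iff₀ hc]
  refine le_liminf_of_le (isCoboundedUnder_ge_of_le atTop (x := 1) hv) ?_
  have hev := eventually_lt_of_lt_liminf hb' (isBoundedUnder_of ⟨0, hu⟩)
  filter_upwards [h, hφ.eventually hev] with n h1 h2
  rw [div_le_iff₀ hc]
  linarith

theorem EReal.exists_real_between_of_mul_lt {σ z : ℝ} (hσ : 0 < σ) {L : EReal}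
    (h : (σ : EReal) * L < z) : ∃ b : ℝ, L < b ∧ σ * b < z := by
  induction L with
  | bot => exact ⟨z / σ - 1, EReal.bot_lt_coe _, by rw [mul_sub, mul_div_cancel₀ _ hσ.ne']; linarith⟩
  | top => rw [EReal.coe_mul_top_of_pos hσ] at h; simp at h
  | coe l =>
    have h' : l * σ < z := by rw [mul_comm]; exact_mod_cast h
    obtain ⟨b, h1, h2⟩ := exists_between ((lt_div_iff₀ hσ).2 h')
    exact ⟨b, by exact_mod_cast h1, by rw [mul_comm]; exact (lt_div_iff₀ hσ).1 h2⟩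

theorem EReal.limsup_le_mul_limsup_comp {u v s t : ℕ → ℝ} {σ : ℝ} {φ : ℕ → ℕ} (hσ : 0 < σ)
    (hs0 : ∀ n, 0 ≤ s n) (hs : Tendsto s atTop (𝓝 σ)) (ht : Tendsto t atTop (𝓝 0))
    (hφ : Tendsto φ atTop atTop) (h : ∀ᶠ n in atTop, u n ≤ s n * v (φ n) + t n) :
    limsup (fun n => (u n : EReal)) atTop ≤ σ * limsup (fun n => (v n : EReal)) atTop := by
  refine EReal.le_of_forall_lt_iff_le.1 fun z hz => ?_
  obtain ⟨b, hLb, hbz⟩ := EReal.exists_real_between_of_mul_lt hσ hz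
  have hlim : Tendsto (fun n => s n * b + t n) atTop (𝓝 (σ * b)) := by
    simpa using (hs.mul_const b).add ht
  refine limsup_le_of_le (by isBoundedDefault) ?_
  filter_upwards [h, hφ.eventually (eventually_lt_of_limsup_lt hLb), hlim.eventually_lt_const hbz]
    with n h1 h2 h3
  have h4 : v (φ n) < b := by exact_mod_cast h2
  have h5 := mul_le_mul_of_nonneg_left h4.le (hs0 n)
  exact_mod_cast (by linarith : u n ≤ z)

theorem EReal.liminf_le_mul_liminf_comp {u v s t : ℕ → ℝ} {σ : ℝ} {φ : ℕ → ℕ} (hσ : 0 < σ)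
    (hs0 : ∀ n, 0 ≤ s n) (hs : Tendsto s atTop (𝓝 σ)) (ht : Tendsto t atTop (𝓝 0))
    (hφ : Tendsto φ atTop atTop) (h : ∀ᶠ n in atTop, u (φ n) ≤ s n * v n + t n) :
    liminf (fun n => (u n : EReal)) atTop ≤ σ * liminf (fun n => (v n : EReal)) atTop := by
  refine EReal.le_of_forall_lt_iff_le.1 fun z hz => ?_
  obtain ⟨b, hLb, hbz⟩ := EReal.exists_real_between_of_mul_lt hσ hz
  have hlim : Tendsto (fun n => s n * b + t n) atTop (𝓝 (σ * b)) := by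
    simpa using (hs.mul_const b).add ht
  refine liminf_le_of_frequently_le' (hφ.frequently ?_)
  refine ((frequently_lt_of_liminf_lt (by isBoundedDefault) hLb).and_eventually
    (h.and (hlim.eventually_lt_const hbz))).mono ?_
  rintro n ⟨h2, h1, h3⟩
  have h4 : v n < b := by exact_mod_cast h2
  have h5 := mul_le_mul_of_nonneg_left h4.le (hs0 n)
  exact_mod_cast (by linarith : u (φ n) ≤ z)

theorem limsup_nhdsGT_le_of_forall {F G : ℝ → EReal}
    (h : ∀ ε > 0, ∀ᶠ δ in 𝓝[>] (0 : ℝ), F ε ≤ G δ) :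
    limsup F (𝓝[>] 0) ≤ limsup G (𝓝[>] 0) := by
  refine limsup_le_of_le (by isBoundedDefault) ?_
  filter_upwards [self_mem_nhdsWithin] with ε hε
  exact le_limsup_of_frequently_le (h ε hε).frequently (by isBoundedDefault)

theorem tendsto_div_add_const_atTop {k : ℕ} (hk : 0 < k) (c : ℕ) :
    Tendsto (fun n : ℕ => n / k + c) atTop atTop :=
  (tendsto_add_atTop_nat c).comp (Nat.tendsto_div_const_atTop hk.ne')

theorem tendsto_natDiv_add_div {k : ℕ} (hk : 0 < k) (a : ℝ) :
    Tendsto (fun n : ℕ => (((n / k : ℕ) : ℝ) + a) / n) atTop (𝓝 (1 / k)) := by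
  have hk' : (0 : ℝ) < k := by exact_mod_cast hk
  have h1 : Tendsto (fun n : ℕ => (1 : ℝ) / k + a / n) atTop (𝓝 (1 / k)) := by
    simpa using tendsto_const_nhds.add (tendsto_const_div_atTop_nhds_zero_nat a)
  have h2 : Tendsto (fun n : ℕ => (1 : ℝ) / k + (a - 1) / n) atTop (𝓝 (1 / k)) := by
    simpa using tendsto_const_nhds.add (tendsto_const_div_atTop_nhds_zero_nat (a - 1))
  refine tendsto_of_tendsto_of_tendsto_of_le_of_le' h2 h1 ?_ ?_
  · filter_upwards [eventually_gt_atTop 0] with n hn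
    have hn' : (0 : ℝ) < n := by exact_mod_cast hn
    have h3 : (n : ℝ) < k * ((n / k : ℕ) + 1) := by exact_mod_cast Nat.lt_mul_div_succ n hk
    have h4 : (n : ℝ) / k < (n / k : ℕ) + 1 := by rw [div_lt_iff₀ hk']; linarith
    rw [le_div_iff₀ hn', add_mul, div_mul_cancel₀ _ hn'.ne', one_div, inv_mul_eq_div]
    linarith
  · filter_upwards [eventually_gt_atTop 0] with n hn
    have hn' : (0 : ℝ) < n := by exact_mod_cast hn
    have h3 : ((n / k : ℕ) : ℝ) ≤ n / k := Nat.cast_div_le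
    rw [div_le_iff₀ hn', add_mul, div_mul_cancel₀ _ hn'.ne', one_div, inv_mul_eq_div]
    linarith

end Limits

section Entropy

variable {X : Type*} [MetricSpace X]

theorem corrLower_pos [CompactSpace X] {f : X → X} (hf : Continuous f) (m : ℕ) (x : X) {ε : ℝ}
    (hε : 0 < ε) : 0 < corrLower f m x ε := by
  obtain ⟨c, hc, h⟩ := exists_pos_le_corrSum hf m x hε
  refine hc.trans_le (le_liminf_of_le
    (isCoboundedUnder_ge_of_le atTop fun n => corrSum_le_one f m x n ε) ?_)
  filter_upwards [eventually_gt_atTop 0] with n hn using h n hn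

theorem corrUpper_pos [CompactSpace X] {f : X → X} (hf : Continuous f) (m : ℕ) (x : X) {ε : ℝ}
    (hε : 0 < ε) : 0 < corrUpper f m x ε :=
  (corrLower_pos hf m x hε).trans_le (liminf_le_limsup
    (isBoundedUnder_of ⟨1, fun n => corrSum_le_one f m x n ε⟩)
    (isBoundedUnder_of ⟨0, fun n => corrSum_nonneg f m x n ε⟩))

theorem corrUpper_antitone_length (f : X → X) {m m' : ℕ} (h : m ≤ m') (x : X) {ε : ℝ}
    (hε : 0 ≤ ε) : corrUpper f m' x ε ≤ corrUpper f m x ε := by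
  simpa [corrUpper] using limsup_le_mul_limsup_comp one_pos (fun n => corrSum_nonneg f m' x n ε)
    (fun n => corrSum_le_one f m x n ε) tendsto_id
    (Eventually.of_forall fun n => by simpa using corrSum_antitone_length f h x n hε)

theorem corrLower_antitone_length (f : X → X) {m m' : ℕ} (h : m ≤ m') (x : X) {ε : ℝ}
    (hε : 0 ≤ ε) : corrLower f m' x ε ≤ corrLower f m x ε := by
  simpa [corrLower] using liminf_le_mul_liminf_comp one_pos (fun n => corrSum_nonneg f m' x n ε)
    (fun n => corrSum_le_one f m x n ε) tendsto_id
    (Eventually.of_forall fun n => by simpa using corrSum_antitone_length f h x n hε)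

theorem corrUpper_iterate_le {f : X → X} {k : ℕ} (hk : 0 < k) {ε δ : ℝ} (hε : 0 ≤ ε) (hδ : 0 ≤ δ)
    (h : ∀ y z, dist y z ≤ δ → ∀ i < k, dist (f^[i] y) (f^[i] z) ≤ ε) (m : ℕ) (x : X) :
    corrUpper (f^[k]) m x δ ≤ 4 * k ^ 2 * corrUpper f (k * m) x ε := by
  refine limsup_le_mul_limsup_comp (φ := fun n => k * n) (by positivity)
    (fun n => corrSum_nonneg _ m x n δ)
    (fun n => corrSum_le_one _ _ x n ε) (tendsto_id.const_mul_atTop' hk) ?_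
  filter_upwards [eventually_gt_atTop 0] with n hn
  have h1 := corrSum_iterate_le hk hε hδ h m x hn
  have h2 := mul_nonneg (sq_nonneg (k : ℝ)) (corrSum_nonneg f (k * m) x (k * n) ε)
  linarith

theorem corrLower_iterate_le {f : X → X} {k : ℕ} (hk : 0 < k) {ε δ : ℝ} (hε : 0 ≤ ε) (hδ : 0 ≤ δ)
    (h : ∀ y z, dist y z ≤ δ → ∀ i < k, dist (f^[i] y) (f^[i] z) ≤ ε) (m : ℕ) (x : X) :
    corrLower (f^[k]) m x δ ≤ 4 * k ^ 2 * corrLower f (k * m) x ε := by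
  refine liminf_le_mul_liminf_comp (φ := fun n => n / k) (by positivity)
    (fun n => corrSum_nonneg _ m x n δ) (fun n => corrSum_le_one _ _ x n ε)
    (Nat.tendsto_div_const_atTop hk.ne') ?_
  filter_upwards [eventually_ge_atTop k] with n hn
  have hpos : 0 < n / k := Nat.div_pos hn hk
  have hle : k * (n / k) ≤ n := Nat.mul_div_le n k
  have hlt : n < k * (n / k) + k := by simpa [mul_add] using Nat.lt_mul_div_succ n hk
  have hk1 : k * 1 ≤ k * (n / k) := Nat.mul_le_mul_left k hpos
  have h1 := corrSum_iterate_le hk hε hδ h m x hpos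
  have h2 := corrSum_le_of_le_two_mul f (k * m) x (Nat.mul_pos hk hpos) hle (by omega) ε
  have h3 := mul_le_mul_of_nonneg_left h2 (sq_nonneg (k : ℝ))
  linarith

theorem corrUpper_le_iterate {f : X → X} {k : ℕ} (hk : 0 < k) {ε δ : ℝ} (hδ : 0 ≤ δ)
    (hε : 2 * δ ≤ ε) (m : ℕ) (x : X) :
    corrUpper f (k * (m + 1)) x δ ≤ 32 * corrUpper (f^[k]) m x ε := by
  refine limsup_le_mul_limsup_comp (φ := fun n => n / k + 2) (by norm_num)
    (fun n => corrSum_nonneg _ _ x n δ)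
    (fun n => corrSum_le_one _ _ x n ε) (tendsto_div_add_const_atTop hk 2) ?_
  filter_upwards [eventually_ge_atTop k] with n hn
  have hlt : n < k * (n / k + 1) := Nat.lt_mul_div_succ n hk
  have hle : k * (n / k) ≤ n := Nat.mul_div_le n k
  have h1 := corrSum_le_iterate (f := f) hk hδ hε m x (Nat.succ_pos (n / k))
  have h2 := corrSum_le_of_le_two_mul f (k * (m + 1)) x (hk.trans_le hn) hlt.le
    (by rw [mul_add]; omega) δ
  linarith

theorem corrLower_le_iterate {f : X → X} {k : ℕ} (hk : 0 < k) {ε δ : ℝ} (hδ : 0 ≤ δ)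
    (hε : 2 * δ ≤ ε) (m : ℕ) (x : X) :
    corrLower f (k * (m + 1)) x δ ≤ 32 * corrLower (f^[k]) m x ε := by
  refine liminf_le_mul_liminf_comp (φ := fun n => k * (n - 1)) (by norm_num)
    (fun n => corrSum_nonneg _ _ x n δ) (fun n => corrSum_le_one _ _ x n ε)
    ((tendsto_sub_atTop_nat 1).const_mul_atTop' hk) ?_
  filter_upwards [eventually_gt_atTop 1] with n hn
  obtain ⟨j, rfl⟩ : ∃ j, n = j + 1 := ⟨n - 1, by omega⟩
  have h1 := corrSum_le_iterate (f := f) hk hδ hε m x (n := j) (by omega)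
  have h2 := corrSum_nonneg (f^[k]) m x (j + 1) ε
  simp only [Nat.add_sub_cancel]
  linarith

theorem neg_log_le_add_log {a b c : ℝ} (ha : 0 < a) (hb : 0 < b) (hc : 0 < c) (h : a ≤ c * b) :
    -Real.log b ≤ -Real.log a + Real.log c := by
  have := Real.log_le_log ha h
  rw [Real.log_mul hc.ne' hb.ne'] at this
  linarith

theorem tendsto_mul_succ_div (k : ℕ) :
    Tendsto (fun n : ℕ => (k * ((n : ℝ) + 1)) / n) atTop (𝓝 (k : ℝ)) := by
  have h1 : Tendsto (fun n : ℕ => (k : ℝ) + k / n) atTop (𝓝 (k : ℝ)) := by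
    simpa using tendsto_const_nhds.add (tendsto_const_div_atTop_nhds_zero_nat (k : ℝ))
  refine h1.congr' ?_
  filter_upwards [eventually_gt_atTop 0] with n hn
  field_simp

/-- Comparison of the upper growth rates of `a` and `b` when `b` is, up to an additive constant,
at most the subsequence `a (k * (m + 1))`. -/
theorem limsup_rate_le {a b : ℕ → ℝ} {k : ℕ} (hk : 0 < k) {c : ℝ}
    (h : ∀ m, b m ≤ a (k * (m + 1)) + c) :
    limsup (fun m : ℕ => ((1 / (m : ℝ) * b m : ℝ) : EReal)) atTop ≤
      ((k : ℝ) : EReal) * limsup (fun m : ℕ => ((1 / (m : ℝ) * a m : ℝ) : EReal)) atTop := by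
  refine EReal.limsup_le_mul_limsup_comp (φ := fun m => k * (m + 1)) (by exact_mod_cast hk)
    (fun n => by positivity) (tendsto_mul_succ_div k) (tendsto_const_div_atTop_nhds_zero_nat c)
    ((tendsto_add_atTop_nat 1).const_mul_atTop' hk) ?_
  filter_upwards [eventually_gt_atTop 0] with n hn
  have hn' : (0 : ℝ) < n := by exact_mod_cast hn
  have := mul_le_mul_of_nonneg_left (h n) (by positivity : (0 : ℝ) ≤ 1 / n)
  refine this.trans_eq ?_
  push_cast
  field_simp

theorem limsup_rate_ge {a b : ℕ → ℝ} (ha : Monotone a) {k : ℕ} (hk : 0 < k) {c : ℝ}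
    (h : ∀ m, a (k * m) ≤ b m + c) :
    limsup (fun m : ℕ => ((1 / (m : ℝ) * a m : ℝ) : EReal)) atTop ≤
      ((1 / k : ℝ) : EReal) * limsup (fun m : ℕ => ((1 / (m : ℝ) * b m : ℝ) : EReal)) atTop := by
  refine EReal.limsup_le_mul_limsup_comp (φ := fun m => m / k + 1) (by positivity)
    (fun n => by positivity) (tendsto_natDiv_add_div hk 1) (tendsto_const_div_atTop_nhds_zero_nat c)
    (tendsto_div_add_const_atTop hk 1) ?_
  filter_upwards [eventually_gt_atTop 0] with n hn
  have hn' : (0 : ℝ) < n := by exact_mod_cast hn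
  have h1 := (ha (Nat.lt_mul_div_succ n hk).le).trans (h (n / k + 1))
  have := mul_le_mul_of_nonneg_left h1 (by positivity : (0 : ℝ) ≤ 1 / n)
  refine this.trans_eq ?_
  push_cast
  field_simp

theorem liminf_rate_le {a b : ℕ → ℝ} (ha : Monotone a) {k : ℕ} (hk : 0 < k) {c : ℝ}
    (h : ∀ m, b m ≤ a (k * (m + 1)) + c) :
    liminf (fun m : ℕ => ((1 / (m : ℝ) * b m : ℝ) : EReal)) atTop ≤
      ((k : ℝ) : EReal) * liminf (fun m : ℕ => ((1 / (m : ℝ) * a m : ℝ) : EReal)) atTop := by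
  have hφ : Tendsto (fun n => n / k - 1) atTop atTop :=
    (tendsto_sub_atTop_nat 1).comp (Nat.tendsto_div_const_atTop hk.ne')
  have hs : Tendsto (fun n : ℕ => (n : ℝ) / ((n / k - 1 : ℕ) : ℝ)) atTop (𝓝 (k : ℝ)) := by
    have h1 := (tendsto_natDiv_add_div hk (-1)).inv₀ (by positivity)
    simp only [inv_div, div_one] at h1
    refine h1.congr' ?_
    filter_upwards [eventually_ge_atTop k] with n hn
    rw [Nat.cast_sub (Nat.div_pos hn hk), Nat.cast_one, sub_eq_add_neg]
  refine EReal.liminf_le_mul_liminf_comp (by exact_mod_cast hk) (fun n => by positivity) hs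
    ((tendsto_const_div_atTop_nhds_zero_nat c).comp hφ) hφ ?_
  filter_upwards [eventually_gt_atTop 0, hφ.eventually (eventually_gt_atTop 0)] with n hn hpos
  have hn' : (0 : ℝ) < n := by exact_mod_cast hn
  have hp' : (0 : ℝ) < ((n / k - 1 : ℕ) : ℝ) := by exact_mod_cast hpos
  have hle : k * (n / k - 1 + 1) ≤ n := by
    rw [Nat.sub_add_cancel (by omega)]
    exact Nat.mul_div_le n k
  have h1 := (h (n / k - 1)).trans (add_le_add_left (ha hle) c)
  have := mul_le_mul_of_nonneg_left h1 (by positivity : (0 : ℝ) ≤ 1 / ((n / k - 1 : ℕ) : ℝ))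
  refine this.trans_eq ?_
  simp only [Function.comp_apply]
  field_simp

theorem liminf_rate_ge {a b : ℕ → ℝ} {k : ℕ} (hk : 0 < k) {c : ℝ}
    (h : ∀ m, a (k * m) ≤ b m + c) :
    liminf (fun m : ℕ => ((1 / (m : ℝ) * a m : ℝ) : EReal)) atTop ≤
      ((1 / k : ℝ) : EReal) * liminf (fun m : ℕ => ((1 / (m : ℝ) * b m : ℝ) : EReal)) atTop := by
  refine EReal.liminf_le_mul_liminf_comp (φ := fun m => k * m) (s := fun _ => 1 / k)
    (by positivity) (fun n => by positivity) tendsto_const_nhds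
    (tendsto_const_div_atTop_nhds_zero_nat (c / k)) (tendsto_id.const_mul_atTop' hk) ?_
  filter_upwards [eventually_gt_atTop 0] with n hn
  have := mul_le_mul_of_nonneg_left (h n) (by positivity : (0 : ℝ) ≤ 1 / (k * n : ℕ))
  refine this.trans_eq ?_
  push_cast
  field_simp

theorem EReal.natCast_mul_le_of_le_one_div_mul {k : ℕ} (hk : 0 < k) {a b : EReal}
    (h : a ≤ ((1 / k : ℝ) : EReal) * b) : ((k : ℝ) : EReal) * a ≤ b := by
  have hk' : (0 : ℝ) < k := by exact_mod_cast hk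
  refine (mul_le_mul_of_nonneg_left h (by exact_mod_cast hk'.le)).trans_eq ?_
  rw [← mul_assoc, ← EReal.coe_mul, mul_one_div_cancel hk'.ne', EReal.coe_one, one_mul]

theorem eventually_forall_dist_iterate_le [CompactSpace X] {f : X → X} (hf : Continuous f) (k : ℕ)
    {ε : ℝ} (hε : 0 < ε) :
    ∀ᶠ δ in 𝓝[>] (0 : ℝ), ∀ y z, dist y z ≤ δ → ∀ i < k, dist (f^[i] y) (f^[i] z) ≤ ε := by
  have h : ∀ i ∈ Finset.range k, ∀ᶠ δ in 𝓝[>] (0 : ℝ),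
      ∀ y z, dist y z ≤ δ → dist (f^[i] y) (f^[i] z) ≤ ε := fun i _ => by
    obtain ⟨δ, hδ, h⟩ := Metric.uniformContinuous_iff.1
      (CompactSpace.uniformContinuous_of_continuous (hf.iterate i)) ε hε
    filter_upwards [Ioo_mem_nhdsGT hδ] with d hd y z hyz
    exact (h (hyz.trans_lt hd.2)).le
  filter_upwards [(Filter.eventually_all_finset _).2 h] with δ hδ y z hyz i hi
  exact hδ i (Finset.mem_range.2 hi) y z hyz

theorem entrUpper_eq (f : X → X) (x : X) :
    entrUpper f x = limsup (fun ε : ℝ => limsup (fun m : ℕ =>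
      ((1 / (m : ℝ) * -Real.log (corrLower f m x ε) : ℝ) : EReal)) atTop) (𝓝[>] (0 : ℝ)) := by
  simp only [entrUpper, neg_mul, mul_neg]

theorem entrLower_eq (f : X → X) (x : X) :
    entrLower f x = limsup (fun ε : ℝ => liminf (fun m : ℕ =>
      ((1 / (m : ℝ) * -Real.log (corrUpper f m x ε) : ℝ) : EReal)) atTop) (𝓝[>] (0 : ℝ)) := by
  simp only [entrLower, neg_mul, mul_neg]

end Entropy

/-- **Theorem A.** For a compact metric space `X`, continuous `f : X → X`, `k ∈ ℕ` and `x ∈ X`,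
`entr⁺(f^k,x) = k·entr⁺(f,x)` and `entr⁻(f^k,x) = k·entr⁻(f,x)`. -/
theorem entr_iterate {X : Type*} [MetricSpace X] [CompactSpace X] (f : X → X)
    (hf : Continuous f) (k : ℕ) (hk : 0 < k) (x : X) :
    entrUpper (f^[k]) x = (k : EReal) * entrUpper f x ∧
    entrLower (f^[k]) x = (k : EReal) * entrLower f x := by
  have hk0 : (0 : EReal) ≤ ((k : ℝ) : EReal) := by exact_mod_cast k.cast_nonneg
  have hg : Continuous f^[k] := hf.iterate k
  have hcast : (k : EReal) = ((k : ℝ) : EReal) := rfl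
  have hc : (0 : ℝ) < 4 * k ^ 2 := by positivity
  have hsmall : ∀ ε > (0 : ℝ), ∀ᶠ δ in 𝓝[>] (0 : ℝ), 0 < δ ∧ 2 * δ ≤ ε := fun ε hε => by
    filter_upwards [Ioo_mem_nhdsGT (half_pos hε)] with δ hδ
    exact ⟨hδ.1, by linarith [hδ.2]⟩
  rw [entrUpper_eq, entrUpper_eq, entrLower_eq, entrLower_eq, hcast,
    ← EReal.limsup_const_mul_of_nonneg_of_ne_top hk0 (EReal.coe_ne_top _),
    ← EReal.limsup_const_mul_of_nonneg_of_ne_top hk0 (EReal.coe_ne_top _)]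
  refine ⟨le_antisymm ?_ ?_, le_antisymm ?_ ?_⟩ <;>
    refine limsup_nhdsGT_le_of_forall fun ε hε => ?_
  · filter_upwards [hsmall ε hε] with δ hδ
    exact limsup_rate_le hk fun m => neg_log_le_add_log (corrLower_pos hf _ x hδ.1)
      (corrLower_pos hg m x hε) (by norm_num) (corrLower_le_iterate hk hδ.1.le hδ.2 m x)
  · filter_upwards [eventually_forall_dist_iterate_le hf k hε, self_mem_nhdsWithin] with δ hδ hδ0
    refine EReal.natCast_mul_le_of_le_one_div_mul hk (limsup_rate_ge (fun m m' h => ?_) hk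
      fun m => neg_log_le_add_log (corrLower_pos hg m x hδ0) (corrLower_pos hf _ x hε) hc
        (corrLower_iterate_le hk hε.le (le_of_lt hδ0) hδ m x))
    exact neg_le_neg (Real.log_le_log (corrLower_pos hf m' x hε)
      (corrLower_antitone_length f h x hε.le))
  · filter_upwards [hsmall ε hε] with δ hδ
    refine liminf_rate_le (fun m m' h => ?_) hk fun m => neg_log_le_add_log
      (corrUpper_pos hf _ x hδ.1) (corrUpper_pos hg m x hε) (by norm_num)
      (corrUpper_le_iterate hk hδ.1.le hδ.2 m x)
    exact neg_le_neg (Real.log_le_log (corrUpper_pos hf m' x hδ.1)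
      (corrUpper_antitone_length f h x hδ.1.le))
  · filter_upwards [eventually_forall_dist_iterate_le hf k hε, self_mem_nhdsWithin] with δ hδ hδ0
    exact EReal.natCast_mul_le_of_le_one_div_mul hk (liminf_rate_ge hk
      fun m => neg_log_le_add_log (corrUpper_pos hg m x hδ0) (corrUpper_pos hf _ x hε) hc
        (corrUpper_iterate_le hk hε.le (le_of_lt hδ0) hδ m x))
end

section
/- Let (X,ρ) be a compact metric space and f : X → X a continuous map which is uniquely ergodic, i.e., there is exactly one f-invariant Borel probability measure μ on X. Then for every m ∈ ℕ, every x ∈ X, and every ε > 0 at which the function ε' ↦ c^f_m(μ, ε') is continuous, one has č^f_m(x, ε) = ĉ^f_m(x, ε) = c^f_m(μ, ε). -/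
open Filter Topology Set MeasureTheory

/-- The correlation integral `c^f_m(μ,ε) = (μ×μ){(y,z) : ρ^f_m(y,z) ≤ ε}`. -/
noncomputable def corrIntegral {X : Type*} [MetricSpace X] [MeasurableSpace X] (f : X → X)
    (m : ℕ) (μ : MeasureTheory.Measure X) (ε : ℝ) : ℝ :=
  ((μ.prod μ) {q : X × X | bowenDist f m q.1 q.2 ≤ ε}).toReal

/-- The Bowen metric of a continuous map is continuous. -/
lemma continuous_bowenDist {X : Type*} [MetricSpace X] {f : X → X} (hf : Continuous f) (m : ℕ) :
    Continuous fun q : X × X => bowenDist f m q.1 q.2 := by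
  unfold bowenDist
  refine NNReal.continuous_coe.comp (Continuous.finset_sup_apply fun i _ => ?_)
  exact ((hf.iterate i).comp continuous_fst).nndist ((hf.iterate i).comp continuous_snd)

/-- The uniform probability measure on the first `n + 1` points of the orbit of `x`. -/
noncomputable def empiricalMeasure {X : Type*} [MeasurableSpace X] (f : X → X) (x : X) (n : ℕ) :
    Measure X :=
  ((n + 1 : ℕ) : ENNReal)⁻¹ • ∑ i ∈ Finset.range (n + 1), Measure.dirac (f^[i] x)

instance {X : Type*} [MeasurableSpace X] (f : X → X) (x : X) (n : ℕ) :
    IsProbabilityMeasure (empiricalMeasure f x n) where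
  measure_univ := by
    simpa [empiricalMeasure] using
      ENNReal.inv_mul_cancel (a := (n : ENNReal) + 1) (by simp) (by simp)

lemma integral_empiricalMeasure {X : Type*} [TopologicalSpace X] [MeasurableSpace X]
    [OpensMeasurableSpace X] (f : X → X) (x : X) (n : ℕ)
    (g : BoundedContinuousFunction X ℝ) :
    ∫ y, g y ∂(empiricalMeasure f x n) = birkhoffAverage ℝ f g (n + 1) x := by
  rw [empiricalMeasure, integral_smul_measure, integral_finsetSum_measure]
  · have hd (y : X) : ∫ z, g z ∂(Measure.dirac y) = g y :=
      integral_dirac' _ _ g.continuous.measurable.stronglyMeasurable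
    simp only [birkhoffAverage, birkhoffSum, hd, ENNReal.toReal_inv, ENNReal.toReal_natCast]
  · exact fun i _ => g.integrable _

/-- Every weak limit of the empirical measures of an orbit is invariant. -/
lemma map_eq_of_mapClusterPt_empiricalMeasure {X : Type*} [MetricSpace X] [MeasurableSpace X]
    [BorelSpace X] {f : X → X} (hf : Continuous f) (x : X) {ν : ProbabilityMeasure X}
    (hν : MapClusterPt ν atTop fun n : ℕ =>
      (⟨empiricalMeasure f x n, inferInstance⟩ : ProbabilityMeasure X)) :
    (ν : Measure X).map f = ν := by
  obtain ⟨U, hU, hlim⟩ := mapClusterPt_iff_ultrafilter.1 hν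
  have : IsProbabilityMeasure ((ν : Measure X).map f) :=
    Measure.isProbabilityMeasure_map hf.measurable.aemeasurable
  refine ext_of_forall_integral_eq_of_IsFiniteMeasure fun g => ?_
  rw [integral_map hf.measurable.aemeasurable g.continuous.measurable.aestronglyMeasurable]
  have hlim' := ProbabilityMeasure.tendsto_iff_forall_integral_tendsto.1 hlim
  have h₁ := hlim' g
  have h₂ := hlim' (g.compContinuous ⟨f, hf⟩)
  simp only [ProbabilityMeasure.coe_mk, integral_empiricalMeasure] at h₁ h₂
  have hshift (n : ℕ) : birkhoffAverage ℝ f (g.compContinuous ⟨f, hf⟩) (n + 1) x =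
      birkhoffAverage ℝ f g (n + 1) (f x) := by
    simp only [birkhoffAverage, birkhoffSum]
    exact congrArg _ (Finset.sum_congr rfl fun k _ => congrArg g
      ((Function.iterate_succ_apply' f k x).symm.trans (Function.iterate_succ_apply f k x)))
  have hzero : Tendsto (fun n : ℕ => birkhoffAverage ℝ f g (n + 1) (f x) -
      birkhoffAverage ℝ f g (n + 1) x) U (𝓝 0) :=
    ((tendsto_birkhoffAverage_apply_sub_birkhoffAverage' ℝ
      g.isBounded_range f x).comp (tendsto_add_atTop_nat 1)).mono_left hU
  simp only [hshift] at h₂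
  exact sub_eq_zero.1 (tendsto_nhds_unique (h₂.sub h₁) hzero)

/-- In a uniquely ergodic system, the empirical measures of every orbit converge weakly to the
invariant measure. -/
lemma tendsto_empiricalMeasure_of_uniquelyErgodic {X : Type*} [MetricSpace X] [CompactSpace X]
    [MeasurableSpace X] [BorelSpace X] {f : X → X} (hf : Continuous f)
    (μ : ProbabilityMeasure X)
    (huniq : ∀ ν : Measure X, IsProbabilityMeasure ν → ν.map f = ν → ν = μ) (x : X) :
    Tendsto (β := ProbabilityMeasure X)
      (fun n : ℕ => ⟨empiricalMeasure f x n, inferInstance⟩) atTop (𝓝 μ) := by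
  refine le_nhds_of_unique_clusterPt (X := ProbabilityMeasure X) fun ν hν => ?_
  apply Subtype.ext
  exact huniq ν inferInstance (map_eq_of_mapClusterPt_empiricalMeasure hf x hν)

/-- The correlation sum is the correlation integral of the empirical measure. -/
lemma corrSum_succ_eq_corrIntegral {X : Type*} [MetricSpace X] [CompactSpace X]
    [MeasurableSpace X] [BorelSpace X] {f : X → X} (hf : Continuous f) (m : ℕ) (x : X) (n : ℕ)
    (ε : ℝ) :
    corrSum f m x (n + 1) ε = corrIntegral f m (empiricalMeasure f x n) ε := by
  classical
  have hs : MeasurableSet {q : X × X | bowenDist f m q.1 q.2 ≤ ε} :=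
    (isClosed_le (continuous_bowenDist hf m) continuous_const).measurableSet
  have hemp (A : Set X) (hA : MeasurableSet A) : empiricalMeasure f x n A =
      ((n + 1 : ℕ) : ENNReal)⁻¹ * ∑ j ∈ Finset.range (n + 1), A.indicator 1 (f^[j] x) := by
    simp [empiricalMeasure, Measure.dirac_apply' _ hA]
  have hmeas := measurable_measure_prodMk_left (ν := empiricalMeasure f x n) hs
  rw [corrIntegral, Measure.prod_apply hs]
  have hint (h : X → ENNReal) (hh : Measurable h) : ∫⁻ y, h y ∂(empiricalMeasure f x n) =
      ((n + 1 : ℕ) : ENNReal)⁻¹ * ∑ i ∈ Finset.range (n + 1), h (f^[i] x) := by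
    simp [empiricalMeasure, lintegral_finsetSum_measure, lintegral_dirac' _ hh]
  simp_rw [hint _ hmeas, hemp _ (measurable_prodMk_left hs), ← Finset.mul_sum, ← Finset.sum_product']
  have hcard : ∑ q ∈ Finset.range (n + 1) ×ˢ Finset.range (n + 1),
      (Prod.mk (f^[q.1] x) ⁻¹' {q : X × X | bowenDist f m q.1 q.2 ≤ ε}).indicator
        (1 : X → ENNReal) (f^[q.2] x) =
      (((Finset.range (n + 1) ×ˢ Finset.range (n + 1)).filter fun q =>
        bowenDist f m (f^[q.1] x) (f^[q.2] x) ≤ ε).card : ENNReal) := by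
    simp [Set.indicator_apply, Finset.sum_boole]
  rw [hcard, corrSum]
  simp only [ENNReal.toReal_mul, ENNReal.toReal_inv, ENNReal.toReal_natCast]
  rw [div_eq_inv_mul, pow_two, mul_inv, mul_assoc]

/-- At a continuity point of the correlation integral, the sphere of the Bowen metric is null. -/
lemma prod_bowenDist_eq_null {X : Type*} [MetricSpace X] [CompactSpace X]
    [MeasurableSpace X] [BorelSpace X] {f : X → X} (hf : Continuous f) (m : ℕ)
    (μ : Measure X) [IsProbabilityMeasure μ] {ε : ℝ}
    (hcont : ContinuousAt (fun e : ℝ => corrIntegral f m μ e) ε) :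
    (μ.prod μ) {q : X × X | bowenDist f m q.1 q.2 = ε} = 0 := by
  have hs (e : ℝ) : MeasurableSet {q : X × X | bowenDist f m q.1 q.2 ≤ e} :=
    (isClosed_le (continuous_bowenDist hf m) continuous_const).measurableSet
  have hle : ∀ᶠ e in 𝓝[<] ε, (μ.prod μ).real {q : X × X | bowenDist f m q.1 q.2 = ε} ≤
      corrIntegral f m μ ε - corrIntegral f m μ e := by
    filter_upwards [self_mem_nhdsWithin] with e he
    have he : e < ε := he
    rw [corrIntegral, corrIntegral, ← measureReal_def, ← measureReal_def,
      ← measureReal_sdiff (s₁ := {q : X × X | bowenDist f m q.1 q.2 ≤ ε})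
        (s₂ := {q : X × X | bowenDist f m q.1 q.2 ≤ e}) (fun q hq => le_trans hq he.le) (hs e)]
    refine measureReal_mono fun q hq => ⟨le_of_eq hq, fun h => ?_⟩
    exact absurd (le_trans (ge_of_eq hq) h) (not_le.2 he)
  have hlim : Tendsto (fun e => corrIntegral f m μ ε - corrIntegral f m μ e) (𝓝[<] ε) (𝓝 0) := by
    simpa using (tendsto_const_nhds (x := corrIntegral f m μ ε)).sub
      (hcont.tendsto.mono_left nhdsWithin_le_nhds)
  exact (measureReal_eq_zero_iff).1 (le_antisymm (ge_of_tendsto hlim hle) measureReal_nonneg)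

/-- Weak convergence implies convergence of correlation integrals at continuity points of the
limit. -/
lemma tendsto_corrIntegral {X : Type*} [MetricSpace X] [CompactSpace X]
    [MeasurableSpace X] [BorelSpace X] {f : X → X} (hf : Continuous f) (m : ℕ) {ι : Type*}
    {L : Filter ι} {ν : ι → ProbabilityMeasure X} {μ : ProbabilityMeasure X}
    (hν : Tendsto ν L (𝓝 μ)) {ε : ℝ}
    (hcont : ContinuousAt (fun e : ℝ => corrIntegral f m μ e) ε) :
    Tendsto (fun i => corrIntegral f m (ν i) ε) L (𝓝 (corrIntegral f m μ ε)) := by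
  have hprod : Tendsto (fun i => (ν i).prod (ν i)) L (𝓝 (μ.prod μ)) :=
    (ProbabilityMeasure.continuous_prod.tendsto (μ, μ)).comp (hν.prodMk_nhds hν)
  have hfr : ((μ.prod μ : ProbabilityMeasure (X × X)) : Measure (X × X))
      (frontier {q : X × X | bowenDist f m q.1 q.2 ≤ ε}) = 0 :=
    measure_mono_null (frontier_le_subset_eq (continuous_bowenDist hf m) continuous_const)
      (prod_bowenDist_eq_null hf m (μ : Measure X) hcont)
  exact (ENNReal.tendsto_toReal (measure_ne_top _ _)).comp
    (ProbabilityMeasure.tendsto_measure_of_null_frontier_of_tendsto' hprod hfr)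

/-- For a uniquely ergodic system with invariant measure `μ`, for every `m`, every `x ∈ X` and
every `ε > 0` which is a continuity point of `ε' ↦ c^f_m(μ,ε')`:
`č^f_m(x,ε) = ĉ^f_m(x,ε) = c^f_m(μ,ε)`. -/
theorem corr_eq_corrIntegral_of_uniquelyErgodic {X : Type*} [MetricSpace X] [CompactSpace X]
    [MeasurableSpace X] [BorelSpace X] (f : X → X) (hf : Continuous f)
    (μ : MeasureTheory.Measure X) (hprob : MeasureTheory.IsProbabilityMeasure μ)
    (hinv : μ.map f = μ)
    (huniq : ∀ ν : MeasureTheory.Measure X,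
      MeasureTheory.IsProbabilityMeasure ν → ν.map f = ν → ν = μ)
    (m : ℕ) (hm : 0 < m) (x : X) (ε : ℝ) (hε : 0 < ε)
    (hcont : ContinuousAt (fun e : ℝ => corrIntegral f m μ e) ε) :
    corrLower f m x ε = corrIntegral f m μ ε ∧
    corrUpper f m x ε = corrIntegral f m μ ε := by
  have hlim : Tendsto (fun n => corrSum f m x n ε) atTop (𝓝 (corrIntegral f m μ ε)) := by
    rw [← tendsto_add_atTop_iff_nat 1]
    simp only [corrSum_succ_eq_corrIntegral hf]
    exact tendsto_corrIntegral hf m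
      (tendsto_empiricalMeasure_of_uniquelyErgodic hf ⟨μ, hprob⟩ huniq x) hcont
  exact ⟨hlim.liminf_eq, hlim.limsup_eq⟩
end

section
/- Let p ≥ 2 and let (Σ_p, σ) be the one-sided full shift on p symbols. Then for every h ∈ [0, log p] there is a Cantor set X_h ⊆ Σ_p (a nonempty compact perfect totally disconnected subset) such that the local correlation entropy of σ at every x ∈ X_h exists and equals h, i.e., entr⁺(σ,x) = entr⁻(σ,x) = h for every x ∈ X_h. -/
open Filter Topology Set MeasureTheory

/-- The one-sided full shift map `σ` on `Σ_p = {0,…,p−1}^{ℕ₀}`. -/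
def shiftMap (p : ℕ) : (ℕ → Fin p) → (ℕ → Fin p) := fun x n => x (n + 1)

/-- The metric `d(x,y) = 2^{-min{i : x_i ≠ y_i}}` on `Σ_p`
(`PiNat.dist x y = (1/2) ^ PiNat.firstDiff x y` for `x ≠ y`). -/
noncomputable instance fullShiftMetric (p : ℕ) : MetricSpace (ℕ → Fin p) := PiNat.metricSpace

lemma shiftMap_iterate_apply (p i : ℕ) (x : ℕ → Fin p) (n : ℕ) :
    (shiftMap p)^[i] x n = x (n + i) := by
  induction i generalizing n with
  | zero => rfl
  | succ i ih =>
    rw [Function.iterate_succ_apply']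
    change (shiftMap p)^[i] x (n + 1) = _
    rw [ih, add_assoc, add_comm 1 i]

lemma exists_dist_le_iff (p : ℕ) {ε : ℝ} (hε : 0 < ε) (hε1 : ε < 1) :
    ∃ k, ∀ y z : ℕ → Fin p, dist y z ≤ ε ↔ ∀ j < k + 1, y j = z j := by
  classical
  have hex : ∃ n : ℕ, (1 / 2 : ℝ) ^ n ≤ ε :=
    (exists_pow_lt_of_lt_one hε one_half_lt_one).imp fun _ => le_of_lt
  obtain ⟨k, hk⟩ : ∃ k, Nat.find hex = k + 1 := by
    refine Nat.exists_eq_succ_of_ne_zero fun h => ?_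
    have := Nat.find_spec hex
    rw [h, pow_zero] at this
    exact absurd this (not_le.2 hε1)
  have hspec := Nat.find_spec hex
  rw [hk] at hspec
  refine ⟨k, fun y z => ⟨fun h => ?_, fun h => ?_⟩⟩
  · rcases eq_or_ne y z with rfl | hne
    · exact fun _ _ => rfl
    · have hd : dist y z = (1 / 2 : ℝ) ^ PiNat.firstDiff y z := PiNat.dist_eq_of_ne hne
      rw [hd] at h
      have := Nat.find_min' hex h
      intro j hj
      exact PiNat.apply_eq_of_lt_firstDiff (by omega)
  · exact le_trans (PiNat.mem_cylinder_iff_dist_le.1 fun i hi => h i hi) hspec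

lemma exists_bowenDist_le_iff (p : ℕ) {ε : ℝ} (hε : 0 < ε) (hε1 : ε < 1) :
    ∃ k, ∀ m, 1 ≤ m → ∀ y z : ℕ → Fin p,
      bowenDist (shiftMap p) m y z ≤ ε ↔ ∀ j < m + k, y j = z j := by
  obtain ⟨k, hk⟩ := exists_dist_le_iff p hε hε1
  refine ⟨k, fun m hm y z => ?_⟩
  have h1 : bowenDist (shiftMap p) m y z ≤ ε ↔
      ∀ i < m, dist ((shiftMap p)^[i] y) ((shiftMap p)^[i] z) ≤ ε := by
    rw [bowenDist, ← NNReal.coe_mk ε hε.le, NNReal.coe_le_coe, Finset.sup_le_iff]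
    simp only [Finset.mem_range, ← NNReal.coe_le_coe, coe_nndist]
  rw [h1]
  simp only [hk, shiftMap_iterate_apply]
  constructor
  · intro h j hj
    rcases lt_or_ge j m with hjm | hjm
    · simpa using h j hjm 0 (by omega)
    · have := h (m - 1) (by omega) (j - (m - 1)) (by omega)
      rwa [Nat.sub_add_cancel (by omega)] at this
  · intro h i hi j hj
    exact h _ (by omega)

/-- The word of length `L` occurring in `x` at position `i`. -/
def wordAt {α : Type*} (x : ℕ → α) (L i : ℕ) : Fin L → α := fun t => x (i + t)

/-- The number of occurrences of the word `w` in `x` at positions less than `n`. -/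
def wordCount {α : Type*} [DecidableEq α] {L : ℕ} (x : ℕ → α) (w : Fin L → α) (n : ℕ) : ℝ :=
  ∑ i ∈ Finset.range n, if wordAt x L i = w then 1 else 0

/-- `x` is generic for the Bernoulli measure with weights `q`: every word occurs in `x` with
frequency the product of the weights of its letters. -/
def IsBernoulliGeneric {α : Type*} [DecidableEq α] (q : α → ℝ) (x : ℕ → α) : Prop :=
  ∀ (L : ℕ) (w : Fin L → α),
    Tendsto (fun n : ℕ => wordCount x w n / n) atTop (𝓝 (∏ t, q (w t)))

lemma sum_wordCount_sq {α : Type*} [DecidableEq α] [Fintype α] (x : ℕ → α) (L n : ℕ) :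
    ∑ w : Fin L → α, wordCount x w n ^ 2 =
      ∑ i ∈ Finset.range n, ∑ j ∈ Finset.range n,
        if wordAt x L i = wordAt x L j then (1 : ℝ) else 0 := by
  simp only [wordCount, sq, Finset.sum_mul_sum]
  rw [Finset.sum_comm]
  refine Finset.sum_congr rfl fun i _ => ?_
  rw [Finset.sum_comm]
  refine Finset.sum_congr rfl fun j _ => ?_
  simp [eq_comm]

lemma wordAt_eq_iff {α : Type*} (x : ℕ → α) (L i j : ℕ) :
    wordAt x L i = wordAt x L j ↔ ∀ t < L, x (t + i) = x (t + j) := by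
  simp only [funext_iff, wordAt, Fin.forall_iff, add_comm]

lemma IsBernoulliGeneric.tendsto_corrSum {p : ℕ} {q : Fin p → ℝ} {x : ℕ → Fin p}
    (hx : IsBernoulliGeneric q x) {m k : ℕ} {ε : ℝ}
    (hk : ∀ y z : ℕ → Fin p, bowenDist (shiftMap p) m y z ≤ ε ↔ ∀ j < m + k, y j = z j) :
    Tendsto (fun n => corrSum (shiftMap p) m x n ε) atTop (𝓝 ((∑ a, q a ^ 2) ^ (m + k))) := by
  have h1 : ∀ n, corrSum (shiftMap p) m x n ε =
      ∑ w : Fin (m + k) → Fin p, (wordCount x w n / n) ^ 2 := by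
    intro n
    simp only [div_pow]
    rw [← Finset.sum_div, sum_wordCount_sq, corrSum, Finset.card_filter, Finset.sum_product]
    push_cast
    congr! 4
    simp only [hk, shiftMap_iterate_apply, wordAt_eq_iff]
  simp only [h1]
  rw [Fintype.sum_pow]
  refine tendsto_finsetSum _ fun w _ => ?_
  rw [Finset.prod_pow]
  exact (hx _ w).pow 2

lemma IsBernoulliGeneric.entr_eq {p : ℕ} {q : Fin p → ℝ} {x : ℕ → Fin p}
    (hx : IsBernoulliGeneric q x) :
    entrUpper (shiftMap p) x = ((-Real.log (∑ a, q a ^ 2) : ℝ) : EReal) ∧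
      entrLower (shiftMap p) x = ((-Real.log (∑ a, q a ^ 2) : ℝ) : EReal) := by
  set s := ∑ a, q a ^ 2
  have hlim (k : ℕ) : Tendsto (fun m : ℕ => ((-(1 / (m : ℝ)) * Real.log (s ^ (m + k)) : ℝ) : EReal))
      atTop (𝓝 ((-Real.log s : ℝ) : EReal)) := by
    refine (continuous_coe_real_ereal.tendsto _).comp ?_
    have h : Tendsto (fun m : ℕ => -Real.log s - k * Real.log s * (1 / (m : ℝ))) atTop
        (𝓝 (-Real.log s - k * Real.log s * 0)) :=
      (tendsto_one_div_atTop_nhds_zero_nat.const_mul _).const_sub _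
    rw [mul_zero, sub_zero] at h
    refine h.congr' ?_
    filter_upwards [eventually_ge_atTop 1] with m hm
    have : (m : ℝ) ≠ 0 := by positivity
    rw [Real.log_pow]
    push_cast
    field_simp
    ring
  have hev : ∀ᶠ ε : ℝ in 𝓝[>] 0, 0 < ε ∧ ε < 1 := Ioo_mem_nhdsGT one_pos
  constructor
  · rw [entrUpper, limsup_congr (v := fun _ => ((-Real.log s : ℝ) : EReal)), limsup_const]
    filter_upwards [hev] with ε hε
    obtain ⟨k, hk⟩ := exists_bowenDist_le_iff p hε.1 hε.2
    refine ((hlim k).congr' ?_).limsup_eq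
    filter_upwards [eventually_ge_atTop 1] with m hm
    rw [corrLower, (hx.tendsto_corrSum (hk m hm)).liminf_eq]
  · rw [entrLower, limsup_congr (v := fun _ => ((-Real.log s : ℝ) : EReal)), limsup_const]
    filter_upwards [hev] with ε hε
    obtain ⟨k, hk⟩ := exists_bowenDist_le_iff p hε.1 hε.2
    refine ((hlim k).congr' ?_).liminf_eq
    filter_upwards [eventually_ge_atTop 1] with m hm
    rw [corrUpper, (hx.tendsto_corrSum (hk m hm)).limsup_eq]

lemma Finset.sum_range_mul_eq_sum_sum {M : Type*} [AddCommMonoid M] (g : ℕ → M) (L N : ℕ) :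
    ∑ i ∈ Finset.range (L * N), g i =
      ∑ r ∈ Finset.range L, ∑ j ∈ Finset.range N, g (L * j + r) := by
  induction N with
  | zero => simp
  | succ N ih =>
    rw [Nat.mul_succ, Finset.sum_range_add, ih]
    simp only [Finset.sum_range_succ, Finset.sum_add_distrib]

lemma wordCount_mono {α : Type*} [DecidableEq α] {L : ℕ} (x : ℕ → α) (w : Fin L → α) :
    Monotone (wordCount x w) := by
  refine monotone_nat_of_le_succ fun n => ?_
  rw [wordCount, wordCount, Finset.sum_range_succ]
  split_ifs <;> simp

lemma tendsto_wordCount_div_of_blocks {α : Type*} [DecidableEq α] {L : ℕ} (hL : 0 < L)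
    (x : ℕ → α) (w : Fin L → α) (c : ℝ)
    (h : ∀ r < L, Tendsto (fun N : ℕ => (∑ j ∈ Finset.range N,
      if wordAt x L (L * j + r) = w then (1 : ℝ) else 0) / N) atTop (𝓝 c)) :
    Tendsto (fun n : ℕ => wordCount x w n / n) atTop (𝓝 c) := by
  have hL' : (L : ℝ) ≠ 0 := by positivity
  refine tendsto_div_of_monotone_of_exists_subseq_tendsto_div _ _ (wordCount_mono x w)
    fun a ha => ⟨fun n => L * n, ?_, ?_, ?_⟩
  · obtain ⟨n₀, hn₀⟩ := exists_nat_gt (1 / (a - 1))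
    filter_upwards [eventually_ge_atTop n₀] with n hn
    have h1 : 1 < (n : ℝ) * (a - 1) := by
      rw [← div_lt_iff₀ (by linarith)]
      exact hn₀.trans_le (by exact_mod_cast hn)
    push_cast
    have : (n : ℝ) + 1 ≤ a * n := by linarith
    calc (L : ℝ) * (n + 1) ≤ L * (a * n) := by gcongr
      _ = a * (L * n) := by ring
  · exact tendsto_id.const_mul_atTop' hL
  · have h2 : Tendsto (fun N : ℕ => (∑ r ∈ Finset.range L, (∑ j ∈ Finset.range N,
        if wordAt x L (L * j + r) = w then (1 : ℝ) else 0) / N) / L) atTop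
        (𝓝 ((∑ _r ∈ Finset.range L, c) / L)) :=
      (tendsto_finsetSum _ fun r hr => h r (Finset.mem_range.1 hr)).div_const _
    have hc : (∑ _r ∈ Finset.range L, c) / L = c := by
      simp [hL']
    rw [hc] at h2
    refine h2.congr fun N => ?_
    rw [wordCount, Finset.sum_range_mul_eq_sum_sum, ← Finset.sum_div, div_div]
    push_cast
    rw [mul_comm (N : ℝ)]

open ProbabilityTheory in
lemma ae_tendsto_block_average {α Ω : Type*} [DecidableEq α] [MeasurableSpace α]
    [MeasurableSingletonClass α] [Countable α] [MeasurableSpace Ω]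
    {P : Measure Ω} [IsProbabilityMeasure P] {μ : Measure α} {X : ℕ → Ω → α}
    (hX : ∀ i, Measurable (X i)) (hlaw : ∀ i, HasLaw (X i) μ P) (hind : iIndepFun X P)
    (L : ℕ) (w : Fin L → α) {r : ℕ} :
    ∀ᵐ ω ∂P, Tendsto (fun N : ℕ => (∑ j ∈ Finset.range N,
      if wordAt (fun i => X i ω) L (L * j + r) = w then (1 : ℝ) else 0) / N) atTop
      (𝓝 (∏ t, μ.real {w t})) := by
  let u : (Fin L → α) → ℝ := fun v => if v = w then 1 else 0
  have hu : Measurable u := measurable_of_countable u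
  let Y : ℕ → Ω → (Fin L → α) := fun j ω t => X (L * j + r + t) ω
  have hY : ∀ j, Measurable (Y j) := fun j => measurable_pi_lambda _ fun t => hX _
  have hindj : ∀ j, iIndepFun (fun (t : Fin L) => X (L * j + r + t)) P := fun j =>
    hind.precomp (g := fun t : Fin L => L * j + r + t) fun a b hab => by
      ext; simpa using hab
  have hint : Integrable (fun ω => u (Y 0 ω)) P := by
    refine Integrable.of_bound (hu.comp (hY 0)).aestronglyMeasurable 1 (ae_of_all _ fun ω => ?_)
    simp only [u]
    split_ifs <;> simp
  have hpair : Pairwise (Function.onFun (· ⟂ᵢ[P] ·) fun j ω => u (Y j ω)) := by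
    intro i j hij
    let S : ℕ → Finset ℕ := fun j => Finset.Ico (L * j + r) (L * j + r + L)
    have hS : Disjoint (S i) (S j) := by
      rw [Finset.disjoint_left]
      intro a ha hb
      simp only [S, Finset.mem_Ico] at ha hb
      rcases lt_or_gt_of_ne hij with h | h
      · have := Nat.mul_le_mul_left L (Nat.succ_le_of_lt h)
        rw [Nat.mul_succ] at this
        omega
      · have := Nat.mul_le_mul_left L (Nat.succ_le_of_lt h)
        rw [Nat.mul_succ] at this
        omega
    let g : ∀ j, (S j → α) → Fin L → α := fun j v t =>
      v ⟨L * j + r + t, by simp [S]⟩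
    have hg : ∀ j, Measurable (fun v => u (g j v)) := fun j =>
      hu.comp (measurable_pi_lambda _ fun t => measurable_pi_apply _)
    exact (hind.indepFun_finset (S i) (S j) hS hX).comp (hg i) (hg j)
  have hident : ∀ j, IdentDistrib (fun ω => u (Y j ω)) (fun ω => u (Y 0 ω)) P P := fun j =>
    (IdentDistrib.pi (X := fun (t : Fin L) => X (L * j + r + t))
      (Y := fun (t : Fin L) => X (L * 0 + r + t))
      (fun t => ⟨(hX _).aemeasurable, (hX _).aemeasurable,
        (hlaw _).map_eq.trans (hlaw _).map_eq.symm⟩) (hindj j) (hindj 0)).comp hu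
  have hval : ∫ ω, u (Y 0 ω) ∂P = ∏ t, μ.real {w t} := by
    have h1 : (fun ω => u (Y 0 ω)) =
        (⋂ t : Fin L, X (L * 0 + r + t) ⁻¹' {w t}).indicator 1 := by
      ext ω
      simp only [u, Y, Set.indicator, Set.mem_iInter, Set.mem_preimage, Set.mem_singleton_iff,
        funext_iff, Pi.one_apply]
    rw [h1, integral_indicator_one
      (MeasurableSet.iInter fun t => hX _ (measurableSet_singleton _)), Measure.real,
      (hindj 0).meas_iInter fun t => ⟨{w t}, measurableSet_singleton _, rfl⟩, ENNReal.toReal_prod]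
    refine Finset.prod_congr rfl fun t _ => ?_
    rw [Measure.real, ← (hlaw _).map_eq, Measure.map_apply (hX _) (measurableSet_singleton _)]
  have := strong_law_ae_real (fun j ω => u (Y j ω)) hint hpair hident
  rw [hval] at this
  exact this

open ProbabilityTheory in
lemma exists_isBernoulliGeneric {α : Type} [DecidableEq α] [Fintype α] {q : α → ℝ}
    (hq0 : ∀ a, 0 ≤ q a) (hq1 : ∑ a, q a = 1) : ∃ x : ℕ → α, IsBernoulliGeneric q x := by
  let _ : MeasurableSpace α := ⊤
  have hsum : ∑ a, ENNReal.ofReal (q a) = 1 := by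
    rw [← ENNReal.ofReal_sum_of_nonneg fun a _ => hq0 a, hq1, ENNReal.ofReal_one]
  let ν := PMF.ofFintype (fun a => ENNReal.ofReal (q a)) hsum
  obtain ⟨Ω, _, P, X, hX, hlaw, hind, hP⟩ := exists_iid ℕ ν.toMeasure
  have hν : ∀ a, ν.toMeasure.real {a} = q a := fun a => by
    rw [Measure.real, PMF.toMeasure_apply_singleton _ _ (measurableSet_singleton a)]
    exact ENNReal.toReal_ofReal (hq0 a)
  have hae : ∀ᵐ ω ∂P, ∀ (L : ℕ) (w : Fin L → α) (r : ℕ),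
      Tendsto (fun N : ℕ => (∑ j ∈ Finset.range N,
        if wordAt (fun i => X i ω) L (L * j + r) = w then (1 : ℝ) else 0) / N) atTop
        (𝓝 (∏ t, q (w t))) := by
    simp only [ae_all_iff, ← hν]
    exact fun L w r => ae_tendsto_block_average hX hlaw hind L w
  obtain ⟨ω, hω⟩ := hae.exists
  refine ⟨fun i => X i ω, fun L w => ?_⟩
  rcases Nat.eq_zero_or_pos L with rfl | hL
  · refine tendsto_const_nhds.congr' ?_
    filter_upwards [eventually_ge_atTop 1] with n hn
    have : (n : ℝ) ≠ 0 := by positivity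
    simp [wordCount, Subsingleton.elim _ w, this]
  · exact tendsto_wordCount_div_of_blocks hL _ w _ fun r _ => hω L w r

lemma tendsto_sum_isSquare_div :
    Tendsto (fun n : ℕ => (∑ i ∈ Finset.range n, if IsSquare i then (1 : ℝ) else 0) / n) atTop
      (𝓝 0) := by
  have hle (n : ℕ) : (∑ i ∈ Finset.range n, if IsSquare i then (1 : ℝ) else 0) ≤ √n + 1 := by
    rw [Finset.sum_boole]
    have hsub : Finset.filter (fun i => IsSquare i) (Finset.range n) ⊆
        (Finset.range (n.sqrt + 1)).image fun k => k * k := by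
      intro i hi
      obtain ⟨hin, k, rfl⟩ := Finset.mem_filter.1 hi
      exact Finset.mem_image.2 ⟨k, Finset.mem_range.2 (Nat.lt_succ_of_le
        (Nat.le_sqrt.2 (Finset.mem_range.1 hin).le)), rfl⟩
    have h1 := (Finset.card_le_card hsub).trans Finset.card_image_le
    rw [Finset.card_range] at h1
    calc _ ≤ ((n.sqrt + 1 : ℕ) : ℝ) := by exact_mod_cast h1
      _ ≤ √n + 1 := by
        push_cast
        gcongr
        exact Real.nat_sqrt_le_real_sqrt
  have hlim : Tendsto (fun n : ℕ => (√n)⁻¹ + (n : ℝ)⁻¹) atTop (𝓝 0) := by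
    have h1 : Tendsto (fun n : ℕ => (√(n : ℝ))⁻¹) atTop (𝓝 0) :=
      tendsto_inv_atTop_zero.comp (Real.tendsto_sqrt_atTop.comp tendsto_natCast_atTop_atTop)
    simpa using h1.add tendsto_inv_atTop_nhds_zero_nat
  refine squeeze_zero (fun n => by positivity) (fun n => ?_) hlim
  calc _ ≤ (√n + 1) / n := by gcongr; exact hle n
    _ = (√n)⁻¹ + (n : ℝ)⁻¹ := by
      rw [add_div, Real.sqrt_div_self', one_div, one_div]

lemma abs_wordCount_sub_le {α : Type*} [DecidableEq α] {L : ℕ} {x z : ℕ → α}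
    {S : ℕ → Prop} [DecidablePred S] (hxz : ∀ i, ¬ S i → x i = z i) (w : Fin L → α) (n : ℕ) :
    |wordCount x w n - wordCount z w n| ≤
      L * ((∑ i ∈ Finset.range n, if S i then (1 : ℝ) else 0) + L) := by
  have h1 (i : ℕ) : |(if wordAt x L i = w then (1 : ℝ) else 0) -
      (if wordAt z L i = w then (1 : ℝ) else 0)| ≤
      ∑ t ∈ Finset.range L, if S (t + i) then (1 : ℝ) else 0 := by
    by_cases hex : ∃ t < L, S (t + i)
    · obtain ⟨t, ht, hS⟩ := hex
      calc _ ≤ (1 : ℝ) := by split_ifs <;> simp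
        _ = if S (t + i) then (1 : ℝ) else 0 := by rw [if_pos hS]
        _ ≤ _ := Finset.single_le_sum (f := fun t => if S (t + i) then (1 : ℝ) else 0)
          (fun _ _ => by positivity) (Finset.mem_range.2 ht)
    · push Not at hex
      have : wordAt x L i = wordAt z L i := by
        funext t
        exact hxz _ (add_comm i (t : ℕ) ▸ hex t t.2)
      rw [this, sub_self, abs_zero]
      positivity
  have h2 (t : ℕ) (ht : t < L) : (∑ i ∈ Finset.range n, if S (t + i) then (1 : ℝ) else 0) ≤
      (∑ i ∈ Finset.range n, if S i then (1 : ℝ) else 0) + L := by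
    have h3 : (∑ i ∈ Finset.range n, if S (t + i) then (1 : ℝ) else 0) ≤
        ∑ i ∈ Finset.range (t + n), if S i then (1 : ℝ) else 0 := by
      rw [Finset.sum_range_add]
      exact le_add_of_nonneg_left (by positivity)
    have h4 : (∑ i ∈ Finset.range t, if S (n + i) then (1 : ℝ) else 0) ≤ L := by
      calc _ ≤ ∑ i ∈ Finset.range t, (1 : ℝ) := by
            gcongr
            split_ifs <;> simp
        _ = t := by simp
        _ ≤ L := by exact_mod_cast ht.le
    rw [add_comm t n, Finset.sum_range_add] at h3
    linarith
  calc |wordCount x w n - wordCount z w n|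
      ≤ ∑ i ∈ Finset.range n, ∑ t ∈ Finset.range L, if S (t + i) then (1 : ℝ) else 0 := by
        rw [wordCount, wordCount, ← Finset.sum_sub_distrib]
        exact (Finset.abs_sum_le_sum_abs _ _).trans (Finset.sum_le_sum fun i _ => h1 i)
    _ ≤ ∑ _t ∈ Finset.range L, ((∑ i ∈ Finset.range n, if S i then (1 : ℝ) else 0) + L) := by
        rw [Finset.sum_comm]
        exact Finset.sum_le_sum fun t ht => h2 t (Finset.mem_range.1 ht)
    _ = _ := by rw [Finset.sum_const, Finset.card_range, nsmul_eq_mul]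

lemma IsBernoulliGeneric.congr_off {α : Type*} [DecidableEq α] {q : α → ℝ} {x z : ℕ → α}
    {S : ℕ → Prop} [DecidablePred S]
    (hS : Tendsto (fun n : ℕ => (∑ i ∈ Finset.range n, if S i then (1 : ℝ) else 0) / n) atTop
      (𝓝 0))
    (hz : IsBernoulliGeneric q z) (hxz : ∀ i, ¬ S i → x i = z i) : IsBernoulliGeneric q x := by
  intro L w
  have hdiff : Tendsto (fun n : ℕ => (wordCount x w n - wordCount z w n) / n) atTop (𝓝 0) := by
    have hb : Tendsto (fun n : ℕ => (L : ℝ) *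
        ((∑ i ∈ Finset.range n, if S i then (1 : ℝ) else 0) / n + L * (n : ℝ)⁻¹)) atTop (𝓝 0) := by
      simpa using (hS.add (tendsto_inv_atTop_nhds_zero_nat.const_mul (L : ℝ))).const_mul (L : ℝ)
    refine squeeze_zero_norm (fun n => ?_) hb
    rw [Real.norm_eq_abs, abs_div, Nat.abs_cast]
    calc _ ≤ L * ((∑ i ∈ Finset.range n, if S i then (1 : ℝ) else 0) + L) / (n : ℝ) := by
          gcongr
          exact abs_wordCount_sub_le hxz w n
      _ = _ := by ring
  have := hdiff.add (hz L w)
  rw [zero_add] at this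
  refine this.congr fun n => ?_
  ring

lemma perfect_setOf_eq_off {α : Type*} [TopologicalSpace α] [T1Space α] [Nontrivial α]
    (z : ℕ → α) {S : ℕ → Prop} (hS : ∀ n, ∃ i ≥ n, S i) :
    Perfect {x : ℕ → α | ∀ i, ¬ S i → x i = z i} := by
  classical
  constructor
  · simp only [ofPred_forall]
    exact isClosed_iInter fun i => isClosed_iInter fun _ =>
      isClosed_singleton.preimage (continuous_apply i)
  · rw [preperfect_iff_nhds]
    intro x hx U hU
    rw [nhds_pi, Filter.mem_pi'] at hU
    obtain ⟨I, t, ht, hsub⟩ := hU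
    obtain ⟨N, hN⟩ := I.bddAbove
    obtain ⟨i, hi, hSi⟩ := hS (N + 1)
    obtain ⟨a, ha⟩ := exists_ne (x i)
    refine ⟨Function.update x i a, ⟨hsub fun j hj => ?_, fun j hj => ?_⟩, fun h => ha ?_⟩
    · rw [Function.update_of_ne]
      · exact mem_of_mem_nhds (ht j)
      · have := hN hj
        omega
    · rw [Function.update_of_ne]
      · exact hx j hj
      · rintro rfl
        exact hj hSi
    · rw [← Function.update_self i a x, h]

lemma exists_weights_sum_sq_eq {p : ℕ} (hp : 0 < p) {s : ℝ} (hs0 : (p : ℝ)⁻¹ ≤ s) (hs1 : s ≤ 1) :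
    ∃ q : Fin p → ℝ, (∀ a, 0 ≤ q a) ∧ ∑ a, q a = 1 ∧ ∑ a, q a ^ 2 = s := by
  have : NeZero p := ⟨hp.ne'⟩
  have hp' : (p : ℝ) ≠ 0 := by positivity
  let Q : ℝ → Fin p → ℝ := fun t a => (1 - t) * (if a = 0 then 1 else 0) + t * (p : ℝ)⁻¹
  have hc : ContinuousOn (fun t => ∑ a, Q t a ^ 2) (Icc 0 1) := by fun_prop
  have hQ0 : ∑ a, Q 0 a ^ 2 = 1 := by simp [Q]
  have hQ1 : ∑ a, Q 1 a ^ 2 = (p : ℝ)⁻¹ := by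
    simp only [Q, sub_self, zero_mul, zero_add, one_mul, Finset.sum_const, Finset.card_univ,
      Fintype.card_fin, nsmul_eq_mul]
    field_simp
  obtain ⟨t, ht, hts⟩ := intermediate_value_Icc' zero_le_one hc
    (show s ∈ Icc _ _ by simpa only [hQ0, hQ1] using ⟨hs0, hs1⟩)
  refine ⟨Q t, fun a => ?_, ?_, hts⟩
  · have := sub_nonneg.2 ht.2
    have := ht.1
    positivity
  · simp [Q, Finset.sum_add_distrib]
    field_simp
    ring

/-- For every `h ∈ [0, log p]` there is a Cantor set `X_h ⊆ Σ_p` such that the local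
correlation entropy of `σ` at every `x ∈ X_h` exists and equals `h`. -/
theorem exists_cantor_set_entr_eq (p : ℕ) (hp : 2 ≤ p) (h : ℝ)
    (h0 : 0 ≤ h) (h1 : h ≤ Real.log p) :
    ∃ C : Set (ℕ → Fin p), C.Nonempty ∧ IsCompact C ∧ Perfect C ∧
      IsTotallyDisconnected C ∧
      ∀ x ∈ C, entrUpper (shiftMap p) x = (h : EReal) ∧
        entrLower (shiftMap p) x = (h : EReal) := by
  have : Nontrivial (Fin p) := Fin.nontrivial_iff_two_le.2 hp
  have hp0 : (0 : ℝ) < p := by positivity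
  obtain ⟨q, hq0, hq1, hqs⟩ := exists_weights_sum_sq_eq (p := p) (by omega)
    (s := Real.exp (-h))
    (by rw [← Real.exp_log (inv_pos.2 hp0), Real.log_inv]; gcongr)
    (Real.exp_le_one_iff.2 (neg_nonpos.2 h0))
  obtain ⟨z, hz⟩ := exists_isBernoulliGeneric hq0 hq1
  have hperf := perfect_setOf_eq_off z (S := IsSquare) fun n => ⟨n * n, Nat.le_mul_self n, n, rfl⟩
  refine ⟨{x | ∀ i, ¬ IsSquare i → x i = z i}, ⟨z, fun _ _ => rfl⟩, hperf.closed.isCompact, hperf,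
    isTotallyDisconnected_of_totallyDisconnectedSpace _, fun x hx => ?_⟩
  have := (hz.congr_off tendsto_sum_isSquare_div hx).entr_eq
  rwa [hqs, Real.log_exp, neg_neg] at this
end

section
/- There exist an integer p ≥ 2 and a nonempty closed shift-invariant set X ⊆ Σ_p such that the subshift (X, σ) is strictly ergodic (minimal and uniquely ergodic), has positive Bowen topological entropy, the local correlation entropy of σ at every y ∈ X exists and is zero (entr⁺(σ,y) = entr⁻(σ,y) = 0 for all y ∈ X), and the correlation entropy of the unique σ-invariant Borel probability measure μ on X is zero (entr⁺(σ,μ) = entr⁻(σ,μ) = 0). -/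
open Filter Topology Set MeasureTheory

/-- The upper correlation entropy of an invariant measure `μ`,
`entr⁺(f,μ) = lim_{ε→0⁺} limsup_m (−1/m) log c^f_m(μ,ε)`. -/
noncomputable def entrMeasUpper {X : Type*} [MetricSpace X] [MeasurableSpace X] (f : X → X)
    (μ : MeasureTheory.Measure X) : EReal :=
  Filter.limsup (fun ε : ℝ =>
      Filter.limsup
        (fun m : ℕ => ((-(1 / (m : ℝ)) * Real.log (corrIntegral f m μ ε) : ℝ) : EReal))
        Filter.atTop)
    (𝓝[>] (0 : ℝ))

/-- The lower correlation entropy of an invariant measure `μ`,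
`entr⁻(f,μ) = lim_{ε→0⁺} liminf_m (−1/m) log c^f_m(μ,ε)`. -/
noncomputable def entrMeasLower {X : Type*} [MetricSpace X] [MeasurableSpace X] (f : X → X)
    (μ : MeasureTheory.Measure X) : EReal :=
  Filter.limsup (fun ε : ℝ =>
      Filter.liminf
        (fun m : ℕ => ((-(1 / (m : ℝ)) * Real.log (corrIntegral f m μ ε) : ℝ) : EReal))
        Filter.atTop)
    (𝓝[>] (0 : ℝ))

namespace BlockSubshift

/-- A sum over `A * L` consecutive indices, grouped into `A` runs of length `L`. -/
theorem sum_range_mul_eq {M : Type*} [AddCommMonoid M] (F : ℕ → M) (A L : ℕ) :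
    ∑ k ∈ Finset.range (A * L), F k
      = ∑ a ∈ Finset.range A, ∑ b ∈ Finset.range L, F (a * L + b) := by
  induction A with
  | zero => simp
  | succ A ih => rw [Nat.succ_mul, Finset.sum_range_add, ih, Finset.sum_range_succ]

/-- There are `(N!)^q` distinct sequences of length `N * (1 + q)` over `N` symbols, each starting
with `0` repeated `N` times and continuing with `q` permutations of the symbols. -/
theorem exists_arrangement (N q : ℕ) [NeZero N] :
    ∃ c : Fin (N.factorial ^ q) → ℕ → Fin N,
      (∀ i j, j < N → c i j = 0) ∧
      (∀ i (g : Fin N → ℝ),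
        ∑ j ∈ Finset.range (N * (1 + q)), g (c i j) = N * g 0 + q * ∑ b, g b) ∧
      (∀ i i', (∀ j < N * (1 + q), c i j = c i' j) → i = i') := by
  have hN : 0 < N := Nat.pos_of_ne_zero (NeZero.ne N)
  let e : Fin (N.factorial ^ q) ≃ (Fin q → Equiv.Perm (Fin N)) :=
    (Fintype.equivFinOfCardEq (by simp [Fintype.card_perm])).symm
  let c : Fin (N.factorial ^ q) → ℕ → Fin N := fun i j =>
    if j < N then 0
    else if h : j / N - 1 < q then e i ⟨j / N - 1, h⟩ ⟨j % N, Nat.mod_lt _ hN⟩ else 0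
  have hc : ∀ i (a : Fin q) (b : Fin N), c i ((a + 1) * N + b) = e i a b := by
    intro i a b
    have h1 : ((a + 1 : ℕ) * N + b) / N = a + 1 := by
      rw [mul_comm, Nat.mul_add_div hN, Nat.div_eq_of_lt b.2, add_zero]
    have h2 : ((a + 1 : ℕ) * N + b) % N = b := by
      rw [mul_comm, Nat.mul_add_mod, Nat.mod_eq_of_lt b.2]
    have h3 : ¬ ((a + 1 : ℕ) * N + b) < N := by
      have : N ≤ (a + 1 : ℕ) * N := Nat.le_mul_of_pos_left _ (Nat.succ_pos _)
      omega
    simp [c, h1, h2, h3]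
  refine ⟨c, fun i j hj => by simp [c, hj], fun i g => ?_, fun i i' h => ?_⟩
  · rw [mul_comm, sum_range_mul_eq, add_comm 1 q, Finset.sum_range_succ', add_comm]
    congr 1
    · rw [Finset.sum_congr rfl (g := fun _ => g 0)]
      · simp
      · intro b hb
        simp [c, Finset.mem_range.1 hb]
    · rw [Finset.sum_range, Finset.sum_congr rfl (g := fun _ => ∑ b, g b)]
      · simp
      · intro a _
        rw [Finset.sum_range, ← Equiv.sum_comp (e i a) g]
        exact Finset.sum_congr rfl fun b _ => congrArg g (hc i a b)
  · apply e.injective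
    funext a
    ext b : 1
    rw [← hc, ← hc]
    apply h
    calc (a + 1 : ℕ) * N + b < (a + 1) * N + N := by have := b.2; omega
      _ = N * (a + 2) := by ring
      _ ≤ N * (1 + q) := Nat.mul_le_mul_left _ (by have := a.2; omega)

/-- The number of times each block is repeated (in permutations) inside a block of the next
level. -/
def reps (n : ℕ) : ℕ := 2 ^ (n + 4)

/-- The number of blocks of level `n`. -/
def blockCount (p : ℕ) : ℕ → ℕ
  | 0 => p
  | n + 1 => (blockCount p n).factorial ^ reps n

/-- The length of the blocks of level `n`. -/
def blockLen (p : ℕ) : ℕ → ℕ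
  | 0 => 1
  | n + 1 => blockCount p n * (1 + reps n) * blockLen p n

section FullShift

variable (p : ℕ)

theorem iterate_shiftMap (x : ℕ → Fin p) (i k : ℕ) : (shiftMap p)^[i] x k = x (i + k) := by
  induction i generalizing x with
  | zero => simp
  | succ i ih => rw [Function.iterate_succ_apply, ih]; simp [shiftMap]; congr 1; omega

/-- A set determined by the first `M` coordinates is a preimage of a set of words. -/
theorem eq_preimage_of_prefix {S : Set (ℕ → Fin p)} (M : ℕ)
    (h : ∀ x y : ℕ → Fin p, (∀ k < M, x k = y k) → x ∈ S → y ∈ S) :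
    S = (fun (x : ℕ → Fin p) (k : Fin M) => x k) ⁻¹'
      ((fun (x : ℕ → Fin p) (k : Fin M) => x k) '' S) := by
  refine Subset.antisymm (subset_preimage_image _ _) ?_
  rintro y ⟨x, hx, hxy⟩
  exact h x y (fun k hk => congrFun hxy ⟨k, hk⟩) hx

theorem isClopen_of_prefix {S : Set (ℕ → Fin p)} (M : ℕ)
    (h : ∀ x y : ℕ → Fin p, (∀ k < M, x k = y k) → x ∈ S → y ∈ S) : IsClopen S := by
  rw [eq_preimage_of_prefix p M h]
  exact (isClopen_discrete _).preimage (by fun_prop)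

theorem measurableSet_of_prefix {S : Set (ℕ → Fin p)} (M : ℕ)
    (h : ∀ x y : ℕ → Fin p, (∀ k < M, x k = y k) → x ∈ S → y ∈ S) : MeasurableSet S := by
  rw [eq_preimage_of_prefix p M h]
  exact measurableSet_preimage (by fun_prop) (Set.toFinite _).measurableSet

theorem dist_le_of_prefix {x y : ℕ → Fin p} {l : ℕ} (h : ∀ k < l, x k = y k) :
    dist x y ≤ (1 / 2) ^ l := by
  refine (PiNat.mem_cylinder_iff_dist_le (E := fun _ => Fin p)).1 ?_
  exact (PiNat.mem_cylinder_iff (E := fun _ => Fin p)).2 h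

theorem continuous_shiftMap : Continuous (shiftMap p) :=
  continuous_pi fun n => continuous_apply (n + 1)

theorem measurable_shiftMap : Measurable (shiftMap p) :=
  measurable_pi_lambda _ fun n => measurable_pi_apply (n + 1)

theorem bowenDist_le_of_prefix {x y : ℕ → Fin p} {m l : ℕ} (h : ∀ k < m + l, x k = y k) :
    bowenDist (shiftMap p) m x y ≤ (1 / 2) ^ l := by
  have : ((Finset.range m).sup fun i => nndist ((shiftMap p)^[i] x) ((shiftMap p)^[i] y))
      ≤ ((1 / 2) ^ l : NNReal) := by
    refine Finset.sup_le fun i hi => ?_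
    rw [Finset.mem_range] at hi
    rw [← NNReal.coe_le_coe, coe_nndist]
    push_cast
    refine dist_le_of_prefix p fun k hk => ?_
    rw [iterate_shiftMap, iterate_shiftMap, h _ (by omega)]
  rw [← NNReal.coe_le_coe] at this
  unfold bowenDist
  simpa only [NNReal.coe_pow, NNReal.coe_div, NNReal.coe_one, NNReal.coe_ofNat] using this

theorem prefix_of_bowenDist_lt {x y : ℕ → Fin p} {m : ℕ}
    (h : bowenDist (shiftMap p) m x y < 1) : ∀ k < m, x k = y k := by
  intro k hk
  have h1 : nndist ((shiftMap p)^[k] x) ((shiftMap p)^[k] y)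
      ≤ (Finset.range m).sup fun i => nndist ((shiftMap p)^[i] x) ((shiftMap p)^[i] y) :=
    Finset.le_sup (f := fun i => nndist ((shiftMap p)^[i] x) ((shiftMap p)^[i] y))
      (Finset.mem_range.2 hk)
  rw [← NNReal.coe_le_coe, coe_nndist] at h1
  have h2 : dist ((shiftMap p)^[k] x) ((shiftMap p)^[k] y) < (1 / 2) ^ 0 := by
    rw [pow_zero]; exact h1.trans_lt h
  have := PiNat.apply_eq_of_dist_lt (E := fun _ => Fin p) h2 le_rfl
  simpa [iterate_shiftMap] using this

end FullShift

variable (p : ℕ) [NeZero p]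

instance blockCount_neZero (n : ℕ) : NeZero (blockCount p n) := by
  cases n with
  | zero => exact inferInstanceAs (NeZero p)
  | succ n => exact ⟨pow_ne_zero _ (Nat.factorial_ne_zero _)⟩

theorem blockCount_pos (n : ℕ) : 0 < blockCount p n := Nat.pos_of_ne_zero (NeZero.ne _)

theorem reps_pos (n : ℕ) : 0 < reps n := by unfold reps; positivity

theorem blockLen_pos (n : ℕ) : 0 < blockLen p n := by
  induction n with
  | zero => exact one_pos
  | succ n ih => exact Nat.mul_pos (Nat.mul_pos (blockCount_pos p n) (by omega)) ih

/-- The sequence of level-`n` blocks which are concatenated to form a level-`n + 1` block. -/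
noncomputable def arr (n : ℕ) : Fin (blockCount p (n + 1)) → ℕ → Fin (blockCount p n) :=
  (exists_arrangement (blockCount p n) (reps n)).choose

theorem arr_eq_zero (n : ℕ) (i : Fin (blockCount p (n + 1))) {j : ℕ} (hj : j < blockCount p n) :
    arr p n i j = 0 :=
  (exists_arrangement (blockCount p n) (reps n)).choose_spec.1 i j hj

theorem sum_arr (n : ℕ) (i : Fin (blockCount p (n + 1))) (g : Fin (blockCount p n) → ℝ) :
    ∑ j ∈ Finset.range (blockCount p n * (1 + reps n)), g (arr p n i j)
      = blockCount p n * g 0 + reps n * ∑ b, g b :=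
  (exists_arrangement (blockCount p n) (reps n)).choose_spec.2.1 i g

theorem arr_injective (n : ℕ) {i i' : Fin (blockCount p (n + 1))}
    (h : ∀ j < blockCount p n * (1 + reps n), arr p n i j = arr p n i' j) : i = i' :=
  (exists_arrangement (blockCount p n) (reps n)).choose_spec.2.2 i i' h

theorem exists_arr_eq (n : ℕ) (i : Fin (blockCount p (n + 1))) (b : Fin (blockCount p n)) :
    ∃ j < blockCount p n * (1 + reps n), arr p n i j = b := by
  by_contra! h
  have h1 := sum_arr p n i fun b' => if b' = b then 1 else 0
  rw [Finset.sum_eq_zero fun j hj => if_neg (h j (Finset.mem_range.1 hj))] at h1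
  have h2 : (0 : ℝ) < reps n := by exact_mod_cast reps_pos n
  have h3 : (0 : ℝ) ≤ blockCount p n * (if (0 : Fin (blockCount p n)) = b then 1 else 0) := by
    positivity
  simp only [Finset.sum_ite_eq', Finset.mem_univ, if_true, mul_one] at h1
  linarith

/-- The blocks: the `i`-th block of level `n` consists of the first `blockLen p n` letters of
`blockWord p n i`. -/
noncomputable def blockWord : (n : ℕ) → Fin (blockCount p n) → ℕ → Fin p
  | 0, i, _ => i
  | n + 1, i, k => blockWord n (arr p n i (k / blockLen p n)) (k % blockLen p n)

/-- Infinite concatenation of level-`n` blocks. -/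
noncomputable def concat (n : ℕ) (c : ℕ → Fin (blockCount p n)) (k : ℕ) : Fin p :=
  blockWord p n (c (k / blockLen p n)) (k % blockLen p n)

theorem concat_mul_add (n : ℕ) (c : ℕ → Fin (blockCount p n)) (j k : ℕ) (hk : k < blockLen p n) :
    concat p n c (j * blockLen p n + k) = blockWord p n (c j) k := by
  have h0 := blockLen_pos p n
  unfold concat
  rw [mul_comm, Nat.mul_add_div h0, Nat.div_eq_of_lt hk, Nat.mul_add_mod, Nat.mod_eq_of_lt hk,
    add_zero]

theorem blockWord_injective (n : ℕ) (i i' : Fin (blockCount p n))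
    (h : ∀ k < blockLen p n, blockWord p n i k = blockWord p n i' k) : i = i' := by
  induction n with
  | zero => exact h 0 one_pos
  | succ n ih =>
    refine arr_injective p n fun j hj => ih _ _ fun k hk => ?_
    have := h (j * blockLen p n + k) (by
      calc j * blockLen p n + k < (j + 1) * blockLen p n := by rw [Nat.succ_mul]; omega
        _ ≤ blockCount p n * (1 + reps n) * blockLen p n := Nat.mul_le_mul_right _ hj)
    have e := fun i => concat_mul_add p n (arr p n i) j k hk
    exact (e i).symm.trans (this.trans (e i'))

/-- A concatenation of blocks is a concatenation of blocks of the previous level. -/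
theorem concat_succ (n : ℕ) (c : ℕ → Fin (blockCount p (n + 1))) :
    concat p (n + 1) c = concat p n fun j =>
      arr p n (c (j / (blockCount p n * (1 + reps n)))) (j % (blockCount p n * (1 + reps n))) := by
  funext k
  simp only [concat, blockWord, blockLen]
  rw [mul_comm (blockCount p n * (1 + reps n)) (blockLen p n), Nat.mod_mul_right_div_self,
    Nat.mod_mul_right_mod, Nat.div_div_eq_div_mul]

theorem exists_concat_eq {n m : ℕ} (h : n ≤ m) (c : ℕ → Fin (blockCount p m)) :
    ∃ c', concat p m c = concat p n c' := by
  induction m, h using Nat.le_induction with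
  | base => exact ⟨c, rfl⟩
  | succ m _ ih =>
    obtain ⟨c', hc'⟩ := ih _
    exact ⟨c', (concat_succ p m c).trans hc'⟩

theorem blockWord_eq_concat {n m : ℕ} (h : n ≤ m) (i : Fin (blockCount p m)) :
    ∃ c, ∀ k < blockLen p m, blockWord p m i k = concat p n c k := by
  obtain ⟨c, hc⟩ := exists_concat_eq p h fun _ => i
  refine ⟨c, fun k hk => ?_⟩
  rw [← hc, concat, Nat.mod_eq_of_lt hk]

/-- The block subshift: sequences all of whose prefixes occur inside blocks. -/
def blockShift : Set (ℕ → Fin p) :=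
  {x | ∀ M, ∃ n, ∃ i : Fin (blockCount p n), ∃ t, t + M ≤ blockLen p n ∧
    ∀ k < M, x k = blockWord p n i (t + k)}

theorem mapsTo_blockShift : MapsTo (shiftMap p) (blockShift p) (blockShift p) := by
  intro x hx M
  obtain ⟨n, i, t, ht, h⟩ := hx (M + 1)
  exact ⟨n, i, t + 1, by omega, fun k hk => (h (k + 1) (by omega)).trans (by congr 1; omega)⟩

theorem iterate_mem_blockShift {x : ℕ → Fin p} (hx : x ∈ blockShift p) (i : ℕ) :
    (shiftMap p)^[i] x ∈ blockShift p := (mapsTo_blockShift p).iterate i hx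

/-- A block occurs inside some block of any higher level. -/
theorem exists_occurrence {n m : ℕ} (h : n ≤ m) (i : Fin (blockCount p n)) :
    ∃ i' : Fin (blockCount p m), ∃ s, s + blockLen p n ≤ blockLen p m ∧
      ∀ k < blockLen p n, blockWord p m i' (s + k) = blockWord p n i k := by
  induction m, h using Nat.le_induction with
  | base => exact ⟨i, 0, by simp, by simp⟩
  | succ m _ ih =>
    obtain ⟨i', s, hs, h⟩ := ih
    obtain ⟨j, hj, hj'⟩ := exists_arr_eq p m 0 i'
    refine ⟨0, j * blockLen p m + s, ?_, fun k hk => ?_⟩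
    · calc j * blockLen p m + s + blockLen p n
          ≤ (j + 1) * blockLen p m := by rw [Nat.succ_mul]; omega
        _ ≤ _ := Nat.mul_le_mul_right _ hj
    · rw [add_assoc, ← h k hk, ← hj']
      exact concat_mul_add p m (arr p m 0) j (s + k) (by omega)

/-- Every finite window of a point of the subshift is a window in a concatenation of level-`n`
blocks. -/
theorem exists_window {x : ℕ → Fin p} (hx : x ∈ blockShift p) (n T : ℕ) :
    ∃ t < blockLen p n, ∃ c, ∀ k < T, x k = concat p n c (t + k) := by
  obtain ⟨m, i, t, ht, h⟩ := hx T
  obtain ⟨i', s, hs, h'⟩ := exists_occurrence p (le_max_left m n) i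
  obtain ⟨c, hc⟩ := blockWord_eq_concat p (le_max_right m n) i'
  have hL := blockLen_pos p n
  refine ⟨(s + t) % blockLen p n, Nat.mod_lt _ hL,
    fun j => c (j + (s + t) / blockLen p n), fun k hk => ?_⟩
  rw [h k hk, ← h' _ (by omega), hc _ (by omega)]
  have e : s + (t + k) = ((s + t) % blockLen p n + k) + blockLen p n * ((s + t) / blockLen p n) := by
    have := Nat.mod_add_div (s + t) (blockLen p n)
    omega
  simp only [concat]
  rw [e, Nat.add_mul_div_left _ _ hL, Nat.add_mul_mod_self_left]

/-- Every window of length `2 * blockLen p n` contains a block of level `n`. -/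
theorem exists_block {x : ℕ → Fin p} (hx : x ∈ blockShift p) (n : ℕ) :
    ∃ s ≤ blockLen p n, ∃ i, ∀ k < blockLen p n, x (s + k) = blockWord p n i k := by
  obtain ⟨t, ht, c, hc⟩ := exists_window p hx n (2 * blockLen p n)
  refine ⟨blockLen p n - t, Nat.sub_le _ _, c 1, fun k hk => ?_⟩
  rw [hc _ (by omega), ← concat_mul_add p n c 1 k hk]
  congr 1
  omega

/-- Every point of the subshift contains every block. -/
theorem exists_block_eq {x : ℕ → Fin p} (hx : x ∈ blockShift p) (n : ℕ)
    (i : Fin (blockCount p n)) :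
    ∃ s, ∀ k < blockLen p n, x (s + k) = blockWord p n i k := by
  obtain ⟨s, -, i', h⟩ := exists_block p hx (n + 1)
  obtain ⟨j, hj, hj'⟩ := exists_arr_eq p n i' i
  refine ⟨s + j * blockLen p n, fun k hk => ?_⟩
  rw [add_assoc, h, ← hj']
  · exact concat_mul_add p n (arr p n i') j k hk
  · calc j * blockLen p n + k < (j + 1) * blockLen p n := by rw [Nat.succ_mul]; omega
      _ ≤ _ := Nat.mul_le_mul_right _ hj

theorem two_mul_blockLen_le (n : ℕ) : 2 * blockLen p n ≤ blockLen p (n + 1) := by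
  refine Nat.mul_le_mul_right _ ?_
  have := reps_pos n
  have := blockCount_pos p n
  nlinarith

theorem lt_blockLen (n : ℕ) : n < blockLen p n := by
  induction n with
  | zero => exact one_pos
  | succ n ih => have := two_mul_blockLen_le p n; omega

theorem blockShift_nonempty : (blockShift p).Nonempty := by
  have key : ∀ k n, k ≤ n → blockWord p n 0 k = blockWord p k 0 k := by
    intro k n h
    induction n, h using Nat.le_induction with
    | base => rfl
    | succ n hn ih =>
      have hk : k < blockLen p n := hn.trans_lt (lt_blockLen p n)
      rw [← ih, blockWord, Nat.div_eq_of_lt hk, Nat.mod_eq_of_lt hk,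
        arr_eq_zero p n 0 (blockCount_pos p n)]
  refine ⟨fun k => blockWord p k 0 k, fun M => ⟨M, 0, 0, ?_, fun k hk => ?_⟩⟩
  · rw [zero_add]; exact (lt_blockLen p M).le
  · rw [zero_add]; exact (key k M hk.le).symm

theorem isClosed_blockShift : IsClosed (blockShift p) := by
  have : blockShift p = ⋂ M, {x | ∃ n, ∃ i : Fin (blockCount p n), ∃ t, t + M ≤ blockLen p n ∧
      ∀ k < M, x k = blockWord p n i (t + k)} := by
    ext x; simp [blockShift]
  rw [this]
  refine isClosed_iInter fun M => (isClopen_of_prefix p M ?_).isClosed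
  rintro x y hxy ⟨n, i, t, ht, h⟩
  exact ⟨n, i, t, ht, fun k hk => (hxy k hk).symm.trans (h k hk)⟩

theorem blockShift_minimal {Y : Set (ℕ → Fin p)} (hYX : Y ⊆ blockShift p) (hY : Y.Nonempty)
    (hc : IsClosed Y) (hm : MapsTo (shiftMap p) Y Y) : Y = blockShift p := by
  refine Subset.antisymm hYX fun z hz => ?_
  obtain ⟨y, hy⟩ := hY
  rw [← hc.closure_eq, Metric.mem_closure_iff]
  intro ε hε
  obtain ⟨l, hl⟩ := exists_pow_lt_of_lt_one hε (by norm_num : (1 / 2 : ℝ) < 1)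
  obtain ⟨n, i, t, ht, h⟩ := hz l
  obtain ⟨s, hs⟩ := exists_block_eq p (hYX hy) n i
  refine ⟨_, hm.iterate (s + t) hy, (dist_le_of_prefix p fun k hk => ?_).trans_lt hl⟩
  rw [iterate_shiftMap, h k hk, add_assoc, hs _ (by omega)]

/-- A lower bound on the Birkhoff sums over the subshift bounds the integral from below. -/
theorem le_mul_integral {μ : Measure (ℕ → Fin p)} [IsProbabilityMeasure μ]
    (hμ : μ.map (shiftMap p) = μ) (hX : μ (blockShift p) = 1) {f : (ℕ → Fin p) → ℝ}
    (hf : Measurable f) (hb : ∀ x, |f x| ≤ 1) {T : ℕ} {a : ℝ}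
    (h : ∀ y ∈ blockShift p, a ≤ ∑ k ∈ Finset.range T, f ((shiftMap p)^[k] y)) :
    a ≤ T * ∫ x, f x ∂μ := by
  have hmp : MeasurePreserving (shiftMap p) μ μ := ⟨measurable_shiftMap p, hμ⟩
  have hint : ∀ k, Integrable (fun x => f ((shiftMap p)^[k] x)) μ := fun k =>
    Integrable.of_bound (hf.comp ((measurable_shiftMap p).iterate k)).aestronglyMeasurable 1
      (Eventually.of_forall fun x => hb _)
  have hk : ∀ k, ∫ x, f ((shiftMap p)^[k] x) ∂μ = ∫ x, f x ∂μ := fun k => by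
    rw [← integral_map (hmp.iterate k).measurable.aemeasurable hf.aestronglyMeasurable,
      (hmp.iterate k).map_eq]
  have hae : ∀ᵐ x ∂μ, x ∈ blockShift p :=
    (prob_compl_eq_zero_iff (isClosed_blockShift p).measurableSet).2 hX
  calc a = ∫ _, a ∂μ := by simp
    _ ≤ ∫ x, ∑ k ∈ Finset.range T, f ((shiftMap p)^[k] x) ∂μ :=
        integral_mono_ae (integrable_const a) (integrable_finsetSum _ fun k _ => hint k)
          (hae.mono h)
    _ = T * ∫ x, f x ∂μ := by
        rw [integral_finsetSum _ fun k _ => hint k, Finset.sum_congr rfl fun k _ => hk k]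
        simp

/-- Shifting the window of summation of a sequence bounded by `1` changes the sum by at most
twice the displacement. -/
theorem abs_sum_shift_sub_le {F : ℕ → ℝ} (hF : ∀ k, |F k| ≤ 1) (t T : ℕ) :
    |∑ k ∈ Finset.range T, F (t + k) - ∑ k ∈ Finset.range T, F k| ≤ 2 * t := by
  have h1 := Finset.sum_range_add F t T
  have h2 := Finset.sum_range_add F T t
  rw [add_comm T t] at h2
  have bd : ∀ G : ℕ → ℝ, (∀ k, |G k| ≤ 1) → |∑ k ∈ Finset.range t, G k| ≤ t := fun G hG =>
    (Finset.abs_sum_le_sum_abs _ _).trans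
      ((Finset.sum_le_sum fun k _ => hG k).trans (by simp))
  have h3 := abs_le.1 (bd F hF)
  have h4 := abs_le.1 (bd (fun k => F (T + k)) fun k => hF _)
  rw [abs_le]
  constructor <;> linarith [h3.1, h3.2, h4.1, h4.2]

/-- Inside a concatenation, the sum over one block is determined by the block up to a boundary
term. -/
theorem abs_sum_concat_sub_le {f : (ℕ → Fin p) → ℝ} (hb : ∀ x, |f x| ≤ 1) {l : ℕ}
    (hl : ∀ x y : ℕ → Fin p, (∀ k < l, x k = y k) → f x = f y) (n : ℕ)
    (d : ℕ → Fin (blockCount p n)) (j : ℕ) :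
    |∑ k ∈ Finset.range (blockLen p n),
        f ((shiftMap p)^[j * blockLen p n + k] (concat p n d))
      - ∑ k ∈ Finset.range (blockLen p n), f ((shiftMap p)^[k] (blockWord p n (d j)))|
      ≤ 2 * l := by
  rw [← Finset.sum_sub_distrib]
  refine (Finset.abs_sum_le_sum_abs _ _).trans ?_
  calc _ ≤ ∑ k ∈ Finset.range (blockLen p n),
        if k ∈ Finset.Ico (blockLen p n - l) (blockLen p n) then (2 : ℝ) else 0 := by
        refine Finset.sum_le_sum fun k hk => ?_
        rw [Finset.mem_range] at hk
        split_ifs with h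
        · have h1 := abs_le.1 (hb ((shiftMap p)^[j * blockLen p n + k] (concat p n d)))
          have h2 := abs_le.1 (hb ((shiftMap p)^[k] (blockWord p n (d j))))
          rw [abs_le]
          constructor <;> linarith [h1.1, h1.2, h2.1, h2.2]
        · rw [Finset.mem_Ico] at h
          rw [hl _ ((shiftMap p)^[k] (blockWord p n (d j))), sub_self, abs_zero]
          intro k' hk'
          rw [iterate_shiftMap, iterate_shiftMap, add_assoc, concat_mul_add p n d j]
          omega
    _ ≤ ∑ k ∈ Finset.Ico (blockLen p n - l) (blockLen p n), (2 : ℝ) := by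
        rw [← Finset.sum_filter]
        exact Finset.sum_le_sum_of_subset_of_nonneg
          (fun k hk => (Finset.mem_filter.1 hk).2) fun _ _ _ => by norm_num
    _ ≤ 2 * l := by
        rw [Finset.sum_const, Nat.card_Ico, nsmul_eq_mul, mul_comm]
        have : ((blockLen p n - (blockLen p n - l) : ℕ) : ℝ) ≤ l := by
          exact_mod_cast (by omega)
        linarith

/-- Birkhoff sums of locally constant functions are nearly constant on the subshift. -/
theorem exists_abs_birkhoff_sub_le {f : (ℕ → Fin p) → ℝ} (hb : ∀ x, |f x| ≤ 1) {l : ℕ}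
    (hl : ∀ x y : ℕ → Fin p, (∀ k < l, x k = y k) → f x = f y) (n A : ℕ) :
    ∃ G : ℝ, ∀ y ∈ blockShift p,
      |∑ k ∈ Finset.range (A * blockLen p (n + 1)), f ((shiftMap p)^[k] y) - G|
        ≤ 2 * blockLen p (n + 1) + A * (blockCount p n * (1 + reps n) : ℕ) * (2 * l) := by
  set K := blockCount p n * (1 + reps n) with hK
  have hKpos : 0 < K := Nat.mul_pos (blockCount_pos p n) (by omega)
  let g : Fin (blockCount p n) → ℝ := fun b =>
    ∑ k ∈ Finset.range (blockLen p n), f ((shiftMap p)^[k] (blockWord p n b))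
  refine ⟨A * (blockCount p n * g 0 + reps n * ∑ b, g b), fun y hy => ?_⟩
  obtain ⟨t, ht, c, hc⟩ := exists_window p hy (n + 1) (A * blockLen p (n + 1) + l)
  set d : ℕ → Fin (blockCount p n) := fun j => arr p n (c (j / K)) (j % K) with hd
  rw [concat_succ, ← hK, ← hd] at hc
  have e1 : ∑ k ∈ Finset.range (A * blockLen p (n + 1)), f ((shiftMap p)^[k] y)
      = ∑ k ∈ Finset.range (A * blockLen p (n + 1)),
          f ((shiftMap p)^[t + k] (concat p n d)) := by
    refine Finset.sum_congr rfl fun k hk => hl _ _ fun k' hk' => ?_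
    rw [Finset.mem_range] at hk
    rw [iterate_shiftMap, iterate_shiftMap, hc _ (by omega), add_assoc]
  have e2 := abs_sum_shift_sub_le (F := fun k => f ((shiftMap p)^[k] (concat p n d)))
    (fun _ => hb _) t (A * blockLen p (n + 1))
  rw [← e1] at e2
  have e3 : ∑ k ∈ Finset.range (A * blockLen p (n + 1)), f ((shiftMap p)^[k] (concat p n d))
      = ∑ j ∈ Finset.range (A * K), ∑ k ∈ Finset.range (blockLen p n),
          f ((shiftMap p)^[j * blockLen p n + k] (concat p n d)) := by
    rw [blockLen, ← mul_assoc, sum_range_mul_eq]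
  have e4 : ∑ j ∈ Finset.range (A * K), g (d j)
      = A * (blockCount p n * g 0 + reps n * ∑ b, g b) := by
    rw [sum_range_mul_eq, Finset.sum_congr rfl
      (g := fun _ => blockCount p n * g 0 + reps n * ∑ b, g b)]
    · rw [Finset.sum_const, Finset.card_range, nsmul_eq_mul]
    · intro a _
      rw [← sum_arr p n (c a)]
      refine Finset.sum_congr rfl fun b hb => ?_
      rw [Finset.mem_range] at hb
      simp only [hd]
      rw [mul_comm a K, Nat.mul_add_div hKpos, Nat.div_eq_of_lt hb, Nat.mul_add_mod,
        Nat.mod_eq_of_lt hb, add_zero]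
  have e5 : |∑ k ∈ Finset.range (A * blockLen p (n + 1)), f ((shiftMap p)^[k] (concat p n d))
      - A * (blockCount p n * g 0 + reps n * ∑ b, g b)| ≤ A * K * (2 * l) := by
    rw [e3, ← e4, ← Finset.sum_sub_distrib]
    refine (Finset.abs_sum_le_sum_abs _ _).trans
      ((Finset.sum_le_sum fun j _ => abs_sum_concat_sub_le p hb hl n d j).trans ?_)
    simp
  have ht' : (t : ℝ) ≤ blockLen p (n + 1) := by exact_mod_cast ht.le
  refine (abs_sub_le _ _ _).trans (add_le_add (e2.trans ?_) e5)
  linarith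

/-- Invariant measures on the subshift agree on locally constant functions. -/
theorem integral_eq_integral {μ ν : Measure (ℕ → Fin p)} [IsProbabilityMeasure μ]
    [IsProbabilityMeasure ν] (hμ : μ.map (shiftMap p) = μ) (hμX : μ (blockShift p) = 1)
    (hν : ν.map (shiftMap p) = ν) (hνX : ν (blockShift p) = 1)
    {f : (ℕ → Fin p) → ℝ} (hf : Measurable f) (hb : ∀ x, |f x| ≤ 1) {l : ℕ}
    (hl : ∀ x y : ℕ → Fin p, (∀ k < l, x k = y k) → f x = f y) :
    ∫ x, f x ∂μ = ∫ x, f x ∂ν := by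
  have key : ∀ n : ℕ, n * |∫ x, f x ∂μ - ∫ x, f x ∂ν| ≤ 4 * (1 + l) := by
    intro n
    set L := blockLen p n with hL
    obtain ⟨G, hG⟩ := exists_abs_birkhoff_sub_le p hb hl n L
    set K := blockCount p n * (1 + reps n) with hK
    have hKpos : (0 : ℝ) < K := by exact_mod_cast Nat.mul_pos (blockCount_pos p n) (by omega)
    have hLpos : (0 : ℝ) < L := by exact_mod_cast blockLen_pos p n
    have hL' : (blockLen p (n + 1) : ℝ) = K * L := by
      rw [blockLen]; push_cast [hK]; ring
    have bd : ∀ (ρ : Measure (ℕ → Fin p)) [IsProbabilityMeasure ρ], ρ.map (shiftMap p) = ρ →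
        ρ (blockShift p) = 1 →
        |(L * blockLen p (n + 1) : ℕ) * ∫ x, f x ∂ρ - G|
          ≤ 2 * blockLen p (n + 1) + L * K * (2 * l) := by
      intro ρ _ hρ hρX
      have h1 := le_mul_integral p hρ hρX hf hb (T := L * blockLen p (n + 1))
        (a := G - (2 * blockLen p (n + 1) + L * K * (2 * l)))
        fun y hy => by linarith [(abs_le.1 (hG y hy)).1]
      have h2 := le_mul_integral p hρ hρX hf.neg (fun x => by simpa using hb x)
        (T := L * blockLen p (n + 1)) (a := - G - (2 * blockLen p (n + 1) + L * K * (2 * l)))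
        fun y hy => by
          simp only [Pi.neg_apply, Finset.sum_neg_distrib]
          linarith [(abs_le.1 (hG y hy)).2]
      simp only [Pi.neg_apply, integral_neg] at h2
      rw [abs_le]
      constructor <;> linarith
    have b1 := abs_le.1 (bd μ hμ hμX)
    have b2 := abs_le.1 (bd ν hν hνX)
    push_cast at b1 b2
    rw [hL'] at b1 b2
    have h3 : |(L * (K * L)) * (∫ x, f x ∂μ - ∫ x, f x ∂ν)| ≤ (K * L) * (4 * (1 + l)) := by
      rw [abs_le]
      constructor <;> linarith [b1.1, b1.2, b2.1, b2.2]
    rw [abs_mul, abs_of_pos (by positivity)] at h3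
    have h4 : L * |∫ x, f x ∂μ - ∫ x, f x ∂ν| ≤ 4 * (1 + l) := by
      refine le_of_mul_le_mul_left ?_ (mul_pos hKpos hLpos)
      linarith
    refine le_trans (mul_le_mul_of_nonneg_right ?_ (abs_nonneg _)) h4
    exact_mod_cast (lt_blockLen p n).le
  by_contra hne
  have hpos : 0 < |∫ x, f x ∂μ - ∫ x, f x ∂ν| := abs_pos.2 (sub_ne_zero.2 hne)
  obtain ⟨n, hn⟩ := exists_nat_gt (4 * (1 + l) / |∫ x, f x ∂μ - ∫ x, f x ∂ν|)
  rw [div_lt_iff₀ hpos] at hn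
  linarith [key n]

theorem invariant_unique {μ ν : Measure (ℕ → Fin p)} [IsProbabilityMeasure μ]
    [IsProbabilityMeasure ν] (hμ : μ.map (shiftMap p) = μ) (hμX : μ (blockShift p) = 1)
    (hν : ν.map (shiftMap p) = ν) (hνX : ν (blockShift p) = 1) : μ = ν := by
  refine ext_of_generate_finite _ generateFrom_measurableCylinders.symm
    isPiSystem_measurableCylinders ?_ (by simp)
  intro s hs
  obtain ⟨I, S, hS, rfl⟩ := (mem_measurableCylinders s).1 hs
  have hm := MeasurableSet.of_mem_measurableCylinders hs
  have := integral_eq_integral p hμ hμX hν hνX (l := I.sup id + 1)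
    (f := (cylinder I S).indicator 1) (measurable_one.indicator hm)
    (fun x => by by_cases h : x ∈ cylinder I S <;> simp [h]) (fun x y hxy => by
      have : x ∈ cylinder I S ↔ y ∈ cylinder I S := by
        simp only [mem_cylinder]
        have e : I.restrict x = I.restrict y := by
          funext i
          exact hxy i (Nat.lt_succ_of_le (Finset.le_sup (f := id) i.2))
        rw [e]
      by_cases h : y ∈ cylinder I S <;> simp [h, this])
  rw [integral_indicator_one hm, integral_indicator_one hm] at this
  exact (measureReal_eq_measureReal_iff).1 this

theorem exists_invariant : ∃ μ : Measure (ℕ → Fin p),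
    IsProbabilityMeasure μ ∧ μ.map (shiftMap p) = μ ∧ μ (blockShift p) = 1 := by
  obtain ⟨x, hx⟩ := blockShift_nonempty p
  let m : ℕ → Measure (ℕ → Fin p) := fun n =>
    ((n + 1 : ℕ) : ENNReal)⁻¹ • ∑ i ∈ Finset.range (n + 1), Measure.dirac ((shiftMap p)^[i] x)
  have hm : ∀ n, IsProbabilityMeasure (m n) := fun n => ⟨by
    simp only [m, Measure.smul_apply, Measure.finsetSum_apply, smul_eq_mul]
    simp only [measure_univ, Finset.sum_const, Finset.card_range, nsmul_eq_mul, mul_one]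
    exact ENNReal.inv_mul_cancel (by simp) (by simp)⟩
  have hint : ∀ n (g : BoundedContinuousFunction (ℕ → Fin p) ℝ),
      ∫ y, g y ∂m n = (n + 1 : ℝ)⁻¹ * ∑ i ∈ Finset.range (n + 1), g ((shiftMap p)^[i] x) := by
    intro n g
    have hg : StronglyMeasurable g := g.continuous.stronglyMeasurable
    simp only [m]
    rw [integral_smul_measure, integral_finsetSum_measure fun i _ => g.integrable _]
    simp only [integral_dirac' _ _ hg, smul_eq_mul]
    congr 1
    rw [ENNReal.toReal_inv, ENNReal.toReal_natCast]
    push_cast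
    rfl
  let P : ℕ → ProbabilityMeasure (ℕ → Fin p) := fun n => ⟨m n, hm n⟩
  obtain ⟨μ, hμ⟩ : ∃ μ, Tendsto P (hyperfilter ℕ) (𝓝 μ) :=
    ⟨_, ((hyperfilter ℕ).map P).le_nhds_lim⟩
  have hU : (hyperfilter ℕ : Filter ℕ) ≤ atTop := by
    rw [← Nat.cofinite_eq_atTop]; exact hyperfilter_le_cofinite
  have hlim := ProbabilityMeasure.tendsto_iff_forall_integral_tendsto.1 hμ
  refine ⟨μ, inferInstance, ?_, ?_⟩
  · have : IsProbabilityMeasure ((μ : Measure (ℕ → Fin p)).map (shiftMap p)) :=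
      Measure.isProbabilityMeasure_map (measurable_shiftMap p).aemeasurable
    refine ext_of_forall_integral_eq_of_IsFiniteMeasure fun g => ?_
    rw [integral_map (measurable_shiftMap p).aemeasurable
      g.continuous.stronglyMeasurable.aestronglyMeasurable]
    let g' := g.compContinuous ⟨shiftMap p, continuous_shiftMap p⟩
    have h0 : Tendsto (fun n : ℕ => ∫ y, g' y ∂m n - ∫ y, g y ∂m n) (hyperfilter ℕ) (𝓝 0) := by
      refine Tendsto.mono_left ?_ hU
      have hz : Tendsto (fun n : ℕ => 2 * ‖g‖ * ((n : ℝ) + 1)⁻¹) atTop (𝓝 0) := by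
        simpa [one_div] using
          (tendsto_one_div_add_atTop_nhds_zero_nat (𝕜 := ℝ)).const_mul (2 * ‖g‖)
      refine squeeze_zero_norm (fun n => ?_) hz
      have e : ∑ i ∈ Finset.range (n + 1), g' ((shiftMap p)^[i] x)
          - ∑ i ∈ Finset.range (n + 1), g ((shiftMap p)^[i] x)
          = g ((shiftMap p)^[n + 1] x) - g x := by
        rw [← Finset.sum_sub_distrib]
        have := Finset.sum_range_sub (fun i => g ((shiftMap p)^[i] x)) (n + 1)
        simp only [Function.iterate_zero, id] at this
        rw [← this]
        refine Finset.sum_congr rfl fun i _ => ?_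
        rw [Function.iterate_succ_apply']
        rfl
      rw [hint, hint, ← mul_sub, e, norm_mul, mul_comm,
        Real.norm_of_nonneg (by positivity : (0 : ℝ) ≤ ((n : ℝ) + 1)⁻¹)]
      refine mul_le_mul_of_nonneg_right ?_ (by positivity)
      calc ‖g ((shiftMap p)^[n + 1] x) - g x‖ ≤ ‖g ((shiftMap p)^[n + 1] x)‖ + ‖g x‖ :=
            norm_sub_le _ _
        _ ≤ 2 * ‖g‖ := by linarith [g.norm_coe_le_norm ((shiftMap p)^[n + 1] x),
            g.norm_coe_le_norm x]
    have h1 := (hlim g').sub (hlim g)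
    exact sub_eq_zero.1 (tendsto_nhds_unique h1 h0)
  · refine le_antisymm prob_le_one ?_
    have h1 := ProbabilityMeasure.limsup_measure_closed_le_of_tendsto hμ (isClosed_blockShift p)
    have h2 : ∀ n, (P n : Measure (ℕ → Fin p)) (blockShift p) = 1 := by
      intro n
      change m n (blockShift p) = 1
      simp only [m, Measure.smul_apply, Measure.finsetSum_apply, smul_eq_mul]
      rw [Finset.sum_congr rfl (g := fun _ => 1) fun i _ =>
        Measure.dirac_apply_of_mem (iterate_mem_blockShift p hx i)]
      simp only [Finset.sum_const, Finset.card_range, nsmul_eq_mul, mul_one]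
      exact ENNReal.inv_mul_cancel (by simp) (by simp)
    simpa [h2] using h1

/-- Sequences starting with the prefix of length `M` of the periodic repetition of the zeroth
block of level `n`. -/
def runSet (n M : ℕ) : Set (ℕ → Fin p) :=
  {x | ∀ k < M, x k = blockWord p n 0 (k % blockLen p n)}

theorem measurableSet_runSet (n M : ℕ) : MeasurableSet (runSet p n M) :=
  measurableSet_of_prefix p M fun _ _ hxy hx k hk => (hxy k hk).symm.trans (hx k hk)

/-- A lower bound for the frequency of `runSet p n M` when `2 * M ≤ blockCount p n * blockLen p n`. -/
noncomputable def runFreq (n : ℕ) : ℝ := 1 / (8 * (1 + reps n) * blockLen p n)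

theorem runFreq_pos (n : ℕ) : 0 < runFreq p n := by
  have : (0 : ℝ) < blockLen p n := by exact_mod_cast blockLen_pos p n
  unfold runFreq
  positivity

theorem half_le_sum_runSet {n M : ℕ} (hM : 2 * M ≤ blockCount p n * blockLen p n)
    {y : ℕ → Fin p} (hy : y ∈ blockShift p) :
    (blockCount p n : ℝ) / 2 ≤ ∑ k ∈ Finset.range (2 * blockLen p (n + 1)),
      (runSet p n M).indicator 1 ((shiftMap p)^[k] y) := by
  obtain ⟨s, hs, i, h⟩ := exists_block p hy (n + 1)
  have hL := blockLen_pos p n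
  have hN := blockCount_pos p n
  have hNL : blockCount p n * blockLen p n ≤ blockLen p (n + 1) :=
    Nat.mul_le_mul_right _ (Nat.le_mul_of_pos_right _ (by omega))
  have hin : ∀ a < blockCount p n / 2 + 1,
      (shiftMap p)^[s + a * blockLen p n] y ∈ runSet p n M := by
    intro a ha k hk
    have h1 : a * blockLen p n + k < blockCount p n * blockLen p n := by
      have : 2 * a * blockLen p n ≤ blockCount p n * blockLen p n :=
        Nat.mul_le_mul_right _ (by omega)
      nlinarith
    rw [iterate_shiftMap, add_assoc, h _ (by omega), blockWord,
      arr_eq_zero p n i (Nat.div_lt_of_lt_mul (h1.trans_eq (mul_comm _ _))), mul_comm,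
      Nat.mul_add_mod]
  have hinj : Function.Injective fun a => s + a * blockLen p n := fun a b hab =>
    Nat.eq_of_mul_eq_mul_right hL (Nat.add_left_cancel hab)
  calc (blockCount p n : ℝ) / 2 ≤ (blockCount p n / 2 + 1 : ℕ) := by
        have : blockCount p n ≤ 2 * (blockCount p n / 2 + 1) := by omega
        have : (blockCount p n : ℝ) ≤ 2 * (blockCount p n / 2 + 1 : ℕ) := by exact_mod_cast this
        linarith
    _ = ∑ k ∈ (Finset.range (blockCount p n / 2 + 1)).image fun a => s + a * blockLen p n,
          (runSet p n M).indicator 1 ((shiftMap p)^[k] y) := by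
        rw [Finset.sum_image fun a _ b _ hab => hinj hab, Finset.sum_congr rfl (g := fun _ => 1)]
        · simp
        · intro a ha
          rw [indicator_of_mem (hin a (Finset.mem_range.1 ha)), Pi.one_apply]
    _ ≤ _ := by
        refine Finset.sum_le_sum_of_subset_of_nonneg ?_ fun k _ _ =>
          indicator_nonneg (fun _ _ => zero_le_one) _
        intro k hk
        obtain ⟨a, ha, rfl⟩ := Finset.mem_image.1 hk
        rw [Finset.mem_range] at ha ⊢
        have : 2 * a * blockLen p n ≤ blockCount p n * blockLen p n :=
          Nat.mul_le_mul_right _ (by omega)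
        have := Nat.mul_pos hN hL
        nlinarith

theorem mul_runFreq_le_sum {n M : ℕ} (hM : 2 * M ≤ blockCount p n * blockLen p n)
    {y : ℕ → Fin p} (hy : y ∈ blockShift p) {T : ℕ} (hT : 2 * blockLen p (n + 1) ≤ T) :
    T * runFreq p n ≤ ∑ k ∈ Finset.range T,
      (runSet p n M).indicator 1 ((shiftMap p)^[k] y) := by
  obtain ⟨W, hW⟩ : ∃ W, W = 2 * blockLen p (n + 1) := ⟨_, rfl⟩
  rw [← hW] at hT
  have hWpos : 0 < W := hW ▸ Nat.mul_pos two_pos (blockLen_pos p (n + 1))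
  have hLpos : (0 : ℝ) < blockLen p n := by exact_mod_cast blockLen_pos p n
  have h1 : T ≤ 2 * (T / W) * W := by
    have h2 := Nat.div_add_mod T W
    have h3 := Nat.mod_lt T hWpos
    have h4 : 1 ≤ T / W := (Nat.one_le_div_iff hWpos).2 hT
    nlinarith
  have h2 : (T : ℝ) ≤ 2 * (T / W : ℕ) * W := by exact_mod_cast h1
  have hWr : (W : ℝ) = 2 * (blockCount p n * (1 + reps n) * blockLen p n) := by
    rw [hW, blockLen]; push_cast; ring
  have h3 : T * runFreq p n ≤ (T / W : ℕ) * ((blockCount p n : ℝ) / 2) := by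
    refine (mul_le_mul_of_nonneg_right h2 (runFreq_pos p n).le).trans_eq ?_
    rw [hWr, runFreq]
    field_simp
    ring
  have h4 : (T / W : ℕ) * ((blockCount p n : ℝ) / 2) ≤ ∑ k ∈ Finset.range (T / W * W),
      (runSet p n M).indicator (1 : (ℕ → Fin p) → ℝ) ((shiftMap p)^[k] y) := by
    have h5 : ∀ a ∈ Finset.range (T / W), (blockCount p n : ℝ) / 2 ≤ ∑ b ∈ Finset.range W,
        (runSet p n M).indicator (1 : (ℕ → Fin p) → ℝ) ((shiftMap p)^[a * W + b] y) := by
      intro a _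
      have := half_le_sum_runSet p hM (iterate_mem_blockShift p hy (a * W))
      rw [← hW] at this
      refine this.trans_eq (Finset.sum_congr rfl fun b _ => ?_)
      rw [← Function.iterate_add_apply, add_comm]
    have h6 := Finset.card_nsmul_le_sum _ _ _ h5
    rw [Finset.card_range, nsmul_eq_mul] at h6
    rwa [sum_range_mul_eq]
  exact h3.trans (h4.trans (Finset.sum_le_sum_of_subset_of_nonneg
    (Finset.range_subset_range.2 (Nat.div_mul_le_self T W))
    fun k _ _ => indicator_nonneg (fun _ _ => zero_le_one) _))

theorem reps_le (n : ℕ) : 1 + reps n ≤ 17 * blockLen p n := by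
  induction n with
  | zero => simp [reps, blockLen]
  | succ n ih =>
    have h1 := two_mul_blockLen_le p n
    have h2 : reps (n + 1) = 2 * reps n := by simp only [reps]; ring
    omega

/-- Every long enough window length is compatible with a level whose run frequency is bounded
below by a polynomial in that length. -/
theorem exists_runFreq_ge {M : ℕ} (hM : p < M) :
    ∃ n, 2 * M ≤ blockCount p n * blockLen p n ∧ 1 / (628864 * (M : ℝ) ^ 4) ≤ runFreq p n := by
  have hex : ∃ n, 2 * M ≤ blockCount p n * blockLen p n := by
    refine ⟨2 * M, ?_⟩
    have := lt_blockLen p (2 * M)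
    have := blockCount_pos p (2 * M)
    nlinarith
  classical
  obtain ⟨n, hn, hmin⟩ : ∃ n, 2 * M ≤ blockCount p n * blockLen p n ∧
      ∀ k < n, ¬ 2 * M ≤ blockCount p k * blockLen p k :=
    ⟨Nat.find hex, Nat.find_spec hex, fun k hk => Nat.find_min hex hk⟩
  refine ⟨n, hn, ?_⟩
  cases n with
  | zero => simp only [blockCount, blockLen] at hn; omega
  | succ n =>
    have h1 := hmin n (Nat.lt_succ_self n)
    have h2 := reps_le p n
    have h3 := reps_le p (n + 1)
    have h4 : blockLen p n ≤ 2 * M := by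
      have := blockCount_pos p n
      nlinarith
    have h5 : blockLen p (n + 1) ≤ 68 * M ^ 2 := by
      calc blockLen p (n + 1) = (blockCount p n * blockLen p n) * (1 + reps n) := by
            rw [blockLen]; ring
        _ ≤ (2 * M) * (17 * (2 * M)) := Nat.mul_le_mul (by omega) (by omega)
        _ = 68 * M ^ 2 := by ring
    have h6 : 8 * (1 + reps (n + 1)) * blockLen p (n + 1) ≤ 628864 * M ^ 4 := by
      calc 8 * (1 + reps (n + 1)) * blockLen p (n + 1)
          ≤ 8 * (17 * (68 * M ^ 2)) * (68 * M ^ 2) :=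
            Nat.mul_le_mul (Nat.mul_le_mul_left _ (h3.trans (Nat.mul_le_mul_left _ h5))) h5
        _ = 628864 * M ^ 4 := by ring
    have hpos : (0 : ℝ) < blockLen p (n + 1) := by exact_mod_cast blockLen_pos p (n + 1)
    refine one_div_le_one_div_of_le (by positivity) ?_
    exact_mod_cast h6

theorem bowenDist_le_of_mem_runSet {x y : ℕ → Fin p} {n m l : ℕ} {ε : ℝ}
    (hl : (1 / 2) ^ l ≤ ε) (hx : x ∈ runSet p n (m + l)) (hy : y ∈ runSet p n (m + l)) :
    bowenDist (shiftMap p) m x y ≤ ε :=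
  (bowenDist_le_of_prefix p fun k hk => (hx k hk).trans (hy k hk).symm).trans hl

theorem sq_runFreq_le_corrSum {y : ℕ → Fin p} (hy : y ∈ blockShift p) {n m l T : ℕ} {ε : ℝ}
    (hl : (1 / 2) ^ l ≤ ε) (hM : 2 * (m + l) ≤ blockCount p n * blockLen p n)
    (hT : 2 * blockLen p (n + 1) ≤ T) :
    runFreq p n ^ 2 ≤ corrSum (shiftMap p) m y T ε := by
  classical
  have hTpos : (0 : ℝ) < T := by
    have := blockLen_pos p (n + 1)
    exact_mod_cast (by omega)
  let S := (Finset.range T).filter fun k => (shiftMap p)^[k] y ∈ runSet p n (m + l)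
  have h1 : T * runFreq p n ≤ S.card := by
    refine (mul_runFreq_le_sum p hM hy hT).trans_eq ?_
    simp [S, indicator_apply, Finset.sum_boole]
  have h2 : (S ×ˢ S).card ≤ ((Finset.range T ×ˢ Finset.range T).filter fun q =>
      bowenDist (shiftMap p) m ((shiftMap p)^[q.1] y) ((shiftMap p)^[q.2] y) ≤ ε).card := by
    refine Finset.card_le_card fun q hq => ?_
    simp only [S, Finset.mem_product, Finset.mem_filter] at hq ⊢
    exact ⟨⟨hq.1.1, hq.2.1⟩, bowenDist_le_of_mem_runSet p hl hq.1.2 hq.2.2⟩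
  rw [Finset.card_product] at h2
  rw [corrSum, le_div_iff₀ (by positivity)]
  calc runFreq p n ^ 2 * T ^ 2 = (T * runFreq p n) * (T * runFreq p n) := by ring
    _ ≤ S.card * S.card := mul_self_le_mul_self
        (mul_nonneg hTpos.le (runFreq_pos p n).le) h1
    _ ≤ _ := by
      have h3 : ((S.card * S.card : ℕ) : ℝ) ≤ _ := Nat.cast_le.2 h2
      push_cast at h3
      convert h3

section General

variable {X : Type*} [MetricSpace X]

theorem corrSum_nonneg (f : X → X) (m : ℕ) (x : X) (n : ℕ) (ε : ℝ) : 0 ≤ corrSum f m x n ε := by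
  unfold corrSum
  positivity

theorem corrSum_le_one (f : X → X) (m : ℕ) (x : X) (n : ℕ) (ε : ℝ) : corrSum f m x n ε ≤ 1 := by
  classical
  unfold corrSum
  refine div_le_one_of_le₀ ?_ (by positivity)
  have : ((Finset.range n ×ˢ Finset.range n).filter fun q =>
      bowenDist f m (f^[q.1] x) (f^[q.2] x) ≤ ε).card ≤ n * n :=
    (Finset.card_filter_le _ _).trans (by simp)
  rw [sq]
  exact_mod_cast (by convert this)

theorem corrLower_corrUpper_bounds {f : X → X} {m : ℕ} {x : X} {ε a : ℝ}
    (h : ∀ᶠ n in atTop, a ≤ corrSum f m x n ε) :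
    a ≤ corrLower f m x ε ∧ corrLower f m x ε ≤ corrUpper f m x ε ∧ corrUpper f m x ε ≤ 1 := by
  have hb : IsBoundedUnder (· ≤ ·) atTop fun n => corrSum f m x n ε :=
    isBoundedUnder_of ⟨1, fun n => corrSum_le_one f m x n ε⟩
  have hb' : IsBoundedUnder (· ≥ ·) atTop fun n => corrSum f m x n ε :=
    isBoundedUnder_of ⟨0, fun n => corrSum_nonneg f m x n ε⟩
  exact ⟨le_liminf_of_le hb.isCoboundedUnder_ge h, liminf_le_limsup hb hb',
    limsup_le_of_le hb'.isCoboundedUnder_le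
      (Eventually.of_forall fun n => corrSum_le_one f m x n ε)⟩

end General

/-- A sequence in `(0, 1]` with a polynomial lower bound has zero exponential decay rate. -/
theorem tendsto_neg_log_div_zero {c : ℕ → ℝ} {C : ℝ} (hC : 0 < C) (l r : ℕ)
    (h : ∀ᶠ m : ℕ in atTop, 1 / (C * ((m + l : ℕ) : ℝ) ^ r) ≤ c m ∧ c m ≤ 1) :
    Tendsto (fun m : ℕ => -(1 / (m : ℝ)) * Real.log (c m)) atTop (𝓝 0) := by
  have hlog : Tendsto (fun m : ℕ => Real.log (m : ℝ) / m) atTop (𝓝 0) := by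
    simpa [Function.comp_def] using (Real.tendsto_pow_log_div_mul_add_atTop 1 0 1 one_ne_zero).comp
      tendsto_natCast_atTop_atTop
  have hinv : Tendsto (fun m : ℕ => (m : ℝ)⁻¹) atTop (𝓝 0) :=
    tendsto_inv_atTop_zero.comp tendsto_natCast_atTop_atTop
  have hup : Tendsto (fun m : ℕ => (Real.log C + r * Real.log 2) * (m : ℝ)⁻¹
      + r * (Real.log (m : ℝ) / m)) atTop (𝓝 0) := by
    simpa using (hinv.const_mul _).add (hlog.const_mul (r : ℝ))
  refine tendsto_of_tendsto_of_tendsto_of_le_of_le' tendsto_const_nhds hup ?_ ?_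
  · filter_upwards [h, eventually_gt_atTop 0] with m hm h0
    have hm0 : (0 : ℝ) < m := by exact_mod_cast h0
    have : 0 ≤ c m := le_trans (by positivity) hm.1
    have := Real.log_nonpos this hm.2
    have : 0 ≤ 1 / (m : ℝ) := by positivity
    nlinarith
  · filter_upwards [h, eventually_gt_atTop 0, eventually_ge_atTop l] with m hm h0 hl
    have hm0 : (0 : ℝ) < m := by exact_mod_cast h0
    have hml : ((m + l : ℕ) : ℝ) ≤ 2 * m := by exact_mod_cast (by omega)
    have hml0 : (0 : ℝ) < (m + l : ℕ) := by exact_mod_cast (by omega)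
    have h1 : 1 / (C * (2 * (m : ℝ)) ^ r) ≤ c m := by
      refine le_trans (one_div_le_one_div_of_le (by positivity) ?_) hm.1
      gcongr
    have h2 := Real.log_le_log (by positivity) h1
    rw [one_div, Real.log_inv, Real.log_mul hC.ne' (by positivity), Real.log_pow,
      Real.log_mul two_ne_zero hm0.ne'] at h2
    calc -(1 / (m : ℝ)) * Real.log (c m) = (m : ℝ)⁻¹ * (- Real.log (c m)) := by ring
      _ ≤ (m : ℝ)⁻¹ * (Real.log C + r * (Real.log 2 + Real.log m)) :=
          mul_le_mul_of_nonneg_left (by linarith) (by positivity)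
      _ = _ := by ring

theorem limsup_limsup_eq_zero {u : ℝ → ℕ → ℝ}
    (h : ∀ ε > 0, Tendsto (u ε) atTop (𝓝 0)) :
    limsup (fun ε : ℝ => limsup (fun m => ((u ε m : ℝ) : EReal)) atTop) (𝓝[>] (0 : ℝ)) = 0 ∧
    limsup (fun ε : ℝ => liminf (fun m => ((u ε m : ℝ) : EReal)) atTop) (𝓝[>] (0 : ℝ)) = 0 := by
  have h' : ∀ ε > 0, Tendsto (fun m => ((u ε m : ℝ) : EReal)) atTop (𝓝 0) := fun ε hε =>
    (continuous_coe_real_ereal.tendsto 0).comp (h ε hε)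
  constructor
  · rw [limsup_congr (v := fun _ => (0 : EReal)), limsup_const]
    filter_upwards [self_mem_nhdsWithin] with ε hε
    exact (h' ε hε).limsup_eq
  · rw [limsup_congr (v := fun _ => (0 : EReal)), limsup_const]
    filter_upwards [self_mem_nhdsWithin] with ε hε
    exact (h' ε hε).liminf_eq

/-- For large `m`, a level and a polynomial lower bound for the squared run frequency. -/
theorem exists_sq_runFreq_ge {m l : ℕ} (hm : p < m) :
    ∃ n, 2 * (m + l) ≤ blockCount p n * blockLen p n ∧
      1 / (628864 ^ 2 * ((m + l : ℕ) : ℝ) ^ 8) ≤ runFreq p n ^ 2 := by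
  obtain ⟨n, hn, hfreq⟩ := exists_runFreq_ge p (M := m + l) (by omega)
  refine ⟨n, hn, le_of_eq_of_le ?_ (pow_le_pow_left₀ (by positivity) hfreq 2)⟩
  rw [div_pow, mul_pow, ← pow_mul, one_pow]

theorem local_corr_entropy_eq_zero {y : ℕ → Fin p} (hy : y ∈ blockShift p) :
    entrUpper (shiftMap p) y = 0 ∧ entrLower (shiftMap p) y = 0 := by
  have key : ∀ ε > 0, ∃ l : ℕ, ∀ᶠ m : ℕ in atTop,
      1 / (628864 ^ 2 * ((m + l : ℕ) : ℝ) ^ 8) ≤ corrLower (shiftMap p) m y ε ∧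
      corrLower (shiftMap p) m y ε ≤ corrUpper (shiftMap p) m y ε ∧
      corrUpper (shiftMap p) m y ε ≤ 1 := by
    intro ε hε
    obtain ⟨l, hl⟩ := exists_pow_lt_of_lt_one hε (by norm_num : (1 / 2 : ℝ) < 1)
    refine ⟨l, ?_⟩
    filter_upwards [eventually_gt_atTop p] with m hm
    obtain ⟨n, hn, hfreq⟩ := exists_sq_runFreq_ge p (l := l) hm
    refine corrLower_corrUpper_bounds ?_
    filter_upwards [eventually_ge_atTop (2 * blockLen p (n + 1))] with T hT
    exact hfreq.trans (sq_runFreq_le_corrSum p hy hl.le hn hT)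
  refine ⟨(limsup_limsup_eq_zero fun ε hε => ?_).1, (limsup_limsup_eq_zero fun ε hε => ?_).2⟩
  all_goals
    obtain ⟨l, hl⟩ := key ε hε
    refine tendsto_neg_log_div_zero (C := 628864 ^ 2) (by positivity) l 8 (hl.mono fun m hm => ?_)
  · exact ⟨hm.1, hm.2.1.trans hm.2.2⟩
  · exact ⟨hm.1.trans hm.2.1, hm.2.2⟩

theorem runFreq_le_measureReal {μ : Measure (ℕ → Fin p)} [IsProbabilityMeasure μ]
    (hμ : μ.map (shiftMap p) = μ) (hX : μ (blockShift p) = 1) {n M : ℕ}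
    (hM : 2 * M ≤ blockCount p n * blockLen p n) : runFreq p n ≤ μ.real (runSet p n M) := by
  have hT : (0 : ℝ) < (2 * blockLen p (n + 1) : ℕ) := by
    have := blockLen_pos p (n + 1)
    exact_mod_cast (by omega)
  have h := le_mul_integral p hμ hX (T := 2 * blockLen p (n + 1))
    (f := (runSet p n M).indicator 1) (measurable_one.indicator (measurableSet_runSet p n M))
    (fun x => by by_cases h : x ∈ runSet p n M <;> simp [h])
    fun y hy => mul_runFreq_le_sum p hM hy le_rfl
  rw [integral_indicator_one (measurableSet_runSet p n M)] at h
  exact le_of_mul_le_mul_left h hT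

theorem measure_corr_entropy_eq_zero {μ : Measure (ℕ → Fin p)} [IsProbabilityMeasure μ]
    (hμ : μ.map (shiftMap p) = μ) (hX : μ (blockShift p) = 1) :
    entrMeasUpper (shiftMap p) μ = 0 ∧ entrMeasLower (shiftMap p) μ = 0 := by
  refine limsup_limsup_eq_zero fun ε hε => ?_
  obtain ⟨l, hl⟩ := exists_pow_lt_of_lt_one hε (by norm_num : (1 / 2 : ℝ) < 1)
  refine tendsto_neg_log_div_zero (C := 628864 ^ 2) (by positivity) l 8 ?_
  filter_upwards [eventually_gt_atTop p] with m hm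
  obtain ⟨n, hn, hfreq⟩ := exists_sq_runFreq_ge p (l := l) hm
  refine ⟨hfreq.trans ?_, measureReal_le_one⟩
  calc runFreq p n ^ 2 ≤ μ.real (runSet p n (m + l)) * μ.real (runSet p n (m + l)) := by
        rw [sq]
        exact mul_self_le_mul_self (runFreq_pos p n).le (runFreq_le_measureReal p hμ hX hn)
    _ = (μ.prod μ).real (runSet p n (m + l) ×ˢ runSet p n (m + l)) :=
        (measureReal_prod_prod _ _).symm
    _ ≤ corrIntegral (shiftMap p) m μ ε := by
        refine measureReal_mono fun q hq => ?_
        exact bowenDist_le_of_mem_runSet p hl.le hq.1 hq.2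

theorem exists_spanning {ε : ℝ} (hε : 0 < ε) (m : ℕ) :
    ∃ A : Finset (ℕ → Fin p), ↑A ⊆ blockShift p ∧
      ∀ y ∈ blockShift p, ∃ a ∈ A, bowenDist (shiftMap p) m y a ≤ ε := by
  classical
  obtain ⟨l, hl⟩ := exists_pow_lt_of_lt_one hε (by norm_num : (1 / 2 : ℝ) < 1)
  let r : (ℕ → Fin p) → Fin (m + l) → Fin p := fun x k => x k
  obtain ⟨B, hB⟩ := (Set.toFinite (r '' blockShift p)).exists_finset_coe
  obtain ⟨A, hA, hAB⟩ := Finset.subset_set_image_iff.1 hB.subset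
  refine ⟨A, hA, fun y hy => ?_⟩
  have hyB : r y ∈ B := by
    rw [← Finset.mem_coe, hB]
    exact mem_image_of_mem r hy
  rw [← hAB] at hyB
  obtain ⟨a, ha, hay⟩ := Finset.mem_image.1 hyB
  exact ⟨a, ha, (bowenDist_le_of_prefix p fun k hk => (congrFun hay ⟨k, hk⟩).symm).trans hl.le⟩

theorem blockCount_le_card {n : ℕ} {ε : ℝ} (hε : ε < 1) {A : Finset (ℕ → Fin p)}
    (hA : ∀ y ∈ blockShift p, ∃ a ∈ A, bowenDist (shiftMap p) (blockLen p n) y a ≤ ε) :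
    blockCount p n ≤ A.card := by
  obtain ⟨x, hx⟩ := blockShift_nonempty p
  have h : ∀ i : Fin (blockCount p n), ∃ a ∈ A, ∀ k < blockLen p n, a k = blockWord p n i k := by
    intro i
    obtain ⟨s, hs⟩ := exists_block_eq p hx n i
    obtain ⟨a, ha, had⟩ := hA _ (iterate_mem_blockShift p hx s)
    refine ⟨a, ha, fun k hk => ?_⟩
    rw [← prefix_of_bowenDist_lt p (had.trans_lt hε) k hk, iterate_shiftMap, hs k hk]
  choose f hfA hf using h
  have hinj : Function.Injective f := fun i j hij =>
    blockWord_injective p n i j fun k hk => by rw [← hf i k hk, hij, hf j k hk]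
  simpa using Finset.card_le_card_of_injOn f (s := Finset.univ) (t := A)
    (fun i _ => hfA i) hinj.injOn

theorem blockCount_le_spanNumOn {n : ℕ} {ε : ℝ} (hε0 : 0 < ε) (hε : ε < 1) :
    blockCount p n ≤ spanNumOn (shiftMap p) (blockShift p) (blockLen p n) ε := by
  obtain ⟨A, hA, hspan⟩ := exists_spanning p hε0 (blockLen p n)
  obtain ⟨B, -, hB, hBspan⟩ := Nat.sInf_mem (s := {k : ℕ | ∃ A : Finset (ℕ → Fin p),
    ↑A ⊆ blockShift p ∧ A.card = k ∧
      ∀ y ∈ blockShift p, ∃ a ∈ A, bowenDist (shiftMap p) (blockLen p n) y a ≤ ε})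
    ⟨A.card, A, hA, rfl, hspan⟩
  exact (blockCount_le_card p hε hBspan).trans_eq hB

theorem mul_log_sub_one_le_log_factorial {N : ℕ} (hN : 0 < N) :
    (N : ℝ) * (Real.log N - 1) ≤ Real.log (N.factorial : ℝ) := by
  have hf : (0 : ℝ) < N.factorial := by exact_mod_cast N.factorial_pos
  have hN0 : (0 : ℝ) < N := by exact_mod_cast hN
  have h := Real.log_le_log (by positivity) (Real.pow_div_factorial_le_exp (N : ℝ) hN0.le N)
  rw [Real.log_exp, Real.log_div (by positivity) hf.ne', Real.log_pow] at h
  linarith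

/-- The logarithm of the number of blocks grows linearly in the block length. -/
theorem log_blockCount_ge {p : ℕ} [NeZero p] (hp : 16 ≤ Real.log p) (n : ℕ) :
    (2 : ℝ) ^ (n + 4) ≤ Real.log (blockCount p n) ∧
      Real.log p / 2 * (1 + (1 / 2) ^ n) * blockLen p n ≤ Real.log (blockCount p n) := by
  induction n with
  | zero =>
    simp only [blockCount, blockLen]
    norm_num
    exact hp
  | succ n ih =>
    obtain ⟨h1, h2⟩ := ih
    have hN : (1 : ℝ) ≤ blockCount p n := by exact_mod_cast blockCount_pos p n
    have hL : (1 : ℝ) ≤ blockLen p n := by exact_mod_cast blockLen_pos p n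
    have hfact := mul_log_sub_one_le_log_factorial (blockCount_pos p n)
    have hlog : Real.log (blockCount p (n + 1))
        = 2 ^ (n + 4) * Real.log ((blockCount p n).factorial : ℝ) := by
      rw [blockCount, Nat.cast_pow, Real.log_pow, reps]
      push_cast
      ring
    have hlen : (blockLen p (n + 1) : ℝ)
        = blockCount p n * (1 + 2 ^ (n + 4)) * blockLen p n := by
      rw [blockLen, reps]
      push_cast
      ring
    have hR : (16 : ℝ) ≤ 2 ^ (n + 4) := by
      rw [pow_add]
      have : (1 : ℝ) ≤ 2 ^ n := one_le_pow₀ one_le_two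
      linarith
    have hq : ((1 : ℝ) / 2) ^ n = 16 / 2 ^ (n + 4) := by
      rw [pow_add, div_pow]
      field_simp
      norm_num
    rw [hq] at h2
    rw [hlog, hlen, pow_succ ((1 : ℝ) / 2), hq, show n + 1 + 4 = (n + 4) + 1 by ring, pow_succ]
    generalize (2 : ℝ) ^ (n + 4) = R at *
    generalize Real.log (blockCount p n) = l at *
    generalize (blockCount p n : ℝ) = N at *
    generalize (blockLen p n : ℝ) = K at *
    generalize Real.log ((blockCount p n).factorial : ℝ) = F at *
    have hR0 : 0 < R := by linarith
    have hd : 0 ≤ Real.log p / 2 * K := by positivity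
    generalize Real.log p = c at *
    have hF : R * (N * (l - 1)) ≤ R * F := by gcongr
    have hl : 2 ≤ N * (l - 1) := by nlinarith
    refine ⟨by nlinarith, ?_⟩
    have h3 : R * (l - 1) ≥ (R - 1) * l := by linarith
    have h4 : (R - 1) * l ≥ (R - 1) * (c / 2 * (1 + 16 / R) * K) :=
      mul_le_mul_of_nonneg_left h2 (by linarith)
    have h5 : (1 + 16 / R * (1 / 2)) * (1 + R) ≤ (R - 1) * (1 + 16 / R) := by
      have h6 : 16 / R * R = 16 := div_mul_cancel₀ _ hR0.ne'
      have h7 : 16 / R ≤ 1 := (div_le_one hR0).2 hR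
      nlinarith
    calc c / 2 * (1 + 16 / R * (1 / 2)) * (N * (1 + R) * K)
        = N * (c / 2 * K * ((1 + 16 / R * (1 / 2)) * (1 + R))) := by ring
      _ ≤ N * (c / 2 * K * ((R - 1) * (1 + 16 / R))) := by gcongr
      _ = N * ((R - 1) * (c / 2 * (1 + 16 / R) * K)) := by ring
      _ ≤ N * (R * (l - 1)) := mul_le_mul_of_nonneg_left (h4.trans h3) (by linarith)
      _ ≤ R * F := by linarith

theorem topEntropyOn_pos {p : ℕ} [NeZero p] (hp : 16 ≤ Real.log p) :
    0 < topEntropyOn (shiftMap p) (blockShift p) := by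
  have hc : (0 : EReal) < ((Real.log p / 2 : ℝ) : EReal) := by
    rw [← EReal.coe_zero, EReal.coe_lt_coe_iff]
    linarith
  refine hc.trans_le (le_limsup_of_frequently_le (Eventually.frequently ?_))
  filter_upwards [Ioo_mem_nhdsGT (zero_lt_one' ℝ)] with ε hε
  refine le_limsup_of_frequently_le (frequently_atTop.2 fun a => ?_)
  refine ⟨blockLen p a, (lt_blockLen p a).le, EReal.coe_le_coe_iff.2 ?_⟩
  have hL : (0 : ℝ) < blockLen p a := by exact_mod_cast blockLen_pos p a
  have hN : (0 : ℝ) < blockCount p a := by exact_mod_cast blockCount_pos p a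
  rw [one_div_mul_eq_div, le_div_iff₀ hL]
  calc Real.log p / 2 * blockLen p a
      ≤ Real.log p / 2 * (1 + (1 / 2) ^ a) * blockLen p a := by
        refine mul_le_mul_of_nonneg_right (le_mul_of_one_le_right (by linarith) ?_) hL.le
        exact le_add_of_nonneg_right (by positivity)
    _ ≤ Real.log (blockCount p a) := (log_blockCount_ge hp a).2
    _ ≤ _ := Real.log_le_log hN (by exact_mod_cast blockCount_le_spanNumOn p hε.1 hε.2)

end BlockSubshift

/-- **Theorem C.** There is a strictly ergodic subshift `(X,σ)` (a nonempty closed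
shift-invariant `X ⊆ Σ_p`, minimal and uniquely ergodic) with positive topological entropy,
whose local correlation entropy at every point is zero, and whose unique invariant measure has
zero correlation entropy. Invariant measures of the subshift are identified with shift-invariant
Borel probability measures on `Σ_p` giving full mass to `X`. -/
theorem exists_strictlyErgodic_positive_entropy_zero_corr_entropy :
    ∃ (p : ℕ), 2 ≤ p ∧ ∃ X : Set (ℕ → Fin p),
      X.Nonempty ∧ IsClosed X ∧ Set.MapsTo (shiftMap p) X X ∧
      -- minimality
      (∀ Y : Set (ℕ → Fin p), Y ⊆ X → Y.Nonempty → IsClosed Y →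
        Set.MapsTo (shiftMap p) Y Y → Y = X) ∧
      -- unique ergodicity
      (∃! μ : MeasureTheory.Measure (ℕ → Fin p),
        MeasureTheory.IsProbabilityMeasure μ ∧ μ.map (shiftMap p) = μ ∧ μ X = 1) ∧
      -- positive Bowen topological entropy
      0 < topEntropyOn (shiftMap p) X ∧
      -- zero local correlation entropy at every point
      (∀ y ∈ X, entrUpper (shiftMap p) y = 0 ∧ entrLower (shiftMap p) y = 0) ∧
      -- zero correlation entropy of the unique invariant measure
      (∀ μ : MeasureTheory.Measure (ℕ → Fin p),
        MeasureTheory.IsProbabilityMeasure μ → μ.map (shiftMap p) = μ → μ X = 1 →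
        entrMeasUpper (shiftMap p) μ = 0 ∧ entrMeasLower (shiftMap p) μ = 0) := by
  obtain ⟨p, hlog, hp⟩ : ∃ p : ℕ, 16 ≤ Real.log p ∧ 2 ≤ p :=
    (((Real.tendsto_log_atTop.comp tendsto_natCast_atTop_atTop).eventually_ge_atTop 16).and
      (eventually_ge_atTop 2)).exists
  have : NeZero p := ⟨by omega⟩
  obtain ⟨μ, hμ, hinv, hX⟩ := BlockSubshift.exists_invariant p
  refine ⟨p, hp, BlockSubshift.blockShift p, BlockSubshift.blockShift_nonempty p,
    BlockSubshift.isClosed_blockShift p, BlockSubshift.mapsTo_blockShift p,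
    fun Y hYX hne hY hmaps => BlockSubshift.blockShift_minimal p hYX hne hY hmaps,
    ⟨μ, ⟨hμ, hinv, hX⟩, fun ν hν => ?_⟩,
    BlockSubshift.topEntropyOn_pos hlog, fun y hy => BlockSubshift.local_corr_entropy_eq_zero p hy,
    fun ν hν hνinv hνX => BlockSubshift.measure_corr_entropy_eq_zero p hνinv hνX⟩
  obtain ⟨hν1, hν2, hν3⟩ := hν
  exact BlockSubshift.invariant_unique p hν2 hν3 hinv hX
end
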